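/- arXiv:math/0703178 — 2 statements merged into one kernel-verified Lean document; each statement's English description precedes it below -/
import Mathlib

section
/- Given three Segre symbols ρ, σ, τ, there exists a polynomial F_{ρσ}^τ ∈ ℤ[T] such that for every finite field k with q elements: (i) F_{ρσ}^τ(q) = Σ_{R ∈ S(ρ,k), S ∈ S(σ,k)} F_{RS}^T for every T ∈ S(τ,k); (ii) n_τ(q)·F_{ρσ}^τ(q) = n_ρ(q)·Σ_{S ∈ S(σ,k), T ∈ S(τ,k)} F_{RS}^T for every R ∈ S(ρ,k); and (iii) n_τ(q)·F_{ρσ}^τ(q) = n_σ(q)·Σ_{R ∈ S(ρ,k), T ∈ S(τ,k)} F_{RS}^T for every S ∈ S(σ,k). Here n_α ∈ ℚ[T] is the polynomial with n_α(q) = |S(α,k)|. In particular, both (n_τ/n_ρ)·F_{ρσ}^τ and (n_τ/n_σ)·F_{ρσ}^τ are polynomials with rational coefficients. -/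
open Polynomial

/-- The `k[t]`-module `⊕_i M(λ_i, p_i)`, where `M(λ,p) = ⊕_{c ∈ λ} k[t]/(p^c)`,
built from a list of pairs (partition, polynomial). -/
abbrev segreModule (k : Type) [Field k] (L : List (List ℕ+ × Polynomial k)) : Type :=
  ∀ i : Fin L.length, ∀ j : Fin (L.get i).1.length,
    Polynomial k ⧸ Ideal.span {((L.get i).2) ^ ((((L.get i).1.get j) : ℕ+) : ℕ)}

/-- `M` belongs to the Segre class `S(σ,k)`, where a Segre symbol `σ` is a multiset of
pairs (partition, degree): `M ≅ ⊕_i M(λ_i,p_i)` for pairwise distinct monic irreducible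
polynomials `p_i` with `deg p_i = d_i`, where `σ = {(λ_1,d_1),…,(λ_r,d_r)}`. -/
def InSegreClass (σ : Multiset (Multiset ℕ+ × ℕ)) (k : Type) [Field k]
    (M : Type) [AddCommGroup M] [Module (Polynomial k) M] : Prop :=
  ∃ L : List (List ℕ+ × Polynomial k),
    (∀ x ∈ L, x.2.Monic ∧ Irreducible x.2) ∧
    (L.map Prod.snd).Nodup ∧
    ((L.map fun x => ((x.1 : Multiset ℕ+), x.2.natDegree) : List _) : Multiset _) = σ ∧
    Nonempty (M ≃ₗ[Polynomial k] segreModule k L)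

/-- The members of the Segre class `S(σ,k)`: since the data `{(λ_i,p_i)}` of a module is
unique, isomorphism classes of modules in `S(σ,k)` correspond exactly to multisets of
pairs (partition, monic irreducible polynomial) with pairwise distinct polynomials and
degrees as prescribed by `σ`. -/
def SegreClassType (σ : Multiset (Multiset ℕ+ × ℕ)) (k : Type) [Field k] : Type :=
  {m : Multiset (Multiset ℕ+ × Polynomial k) //
    (∀ x ∈ m, x.2.Monic ∧ Irreducible x.2) ∧
    (m.map Prod.snd).Nodup ∧
    m.map (fun x => (x.1, x.2.natDegree)) = σ}

/-- A list of data representing the multiset `m`. -/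
noncomputable def dataList (k : Type) [Field k]
    (m : Multiset (Multiset ℕ+ × Polynomial k)) : List (List ℕ+ × Polynomial k) :=
  m.toList.map fun x => (x.1.toList, x.2)

/-- A module representing the isomorphism class encoded by the multiset `m`. -/
noncomputable def moduleOfData (k : Type) [Field k]
    (m : Multiset (Multiset ℕ+ × Polynomial k)) : Type :=
  segreModule k (dataList k m)

noncomputable instance (k : Type) [Field k] (m : Multiset (Multiset ℕ+ × Polynomial k)) :
    AddCommGroup (moduleOfData k m) := by unfold moduleOfData; infer_instance

noncomputable instance (k : Type) [Field k] (m : Multiset (Multiset ℕ+ × Polynomial k)) :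
    Module (Polynomial k) (moduleOfData k m) := by unfold moduleOfData; infer_instance

namespace SegreHall

section core

/-- `p ^ i • U` as a submodule. -/
def pS {R : Type} [CommRing R] (p : R) (i : ℕ) {M : Type} [AddCommGroup M] [Module R M]
    (U : Submodule R M) : Submodule R M := U.map (LinearMap.lsmul R M (p ^ i))

/-- size of the residue field -/
noncomputable def qq {R : Type} [CommRing R] (p : R) : ℕ := Nat.card (R ⧸ Ideal.span {p})

/-- `g` is the length sequence of `M`. -/
def HT {R : Type} [CommRing R] (p : R) (M : Type) [AddCommGroup M] [Module R M]
    (g : ℕ →₀ ℕ) : Prop :=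
  ∀ i, Nat.card (pS p i (⊤ : Submodule R M)) = qq p ^ (g i)

variable {R : Type} [CommRing R] {p : R}
variable {M : Type} [AddCommGroup M] [Module R M]
variable {N : Type} [AddCommGroup N] [Module R N]

lemma mem_pS {i : ℕ} {U : Submodule R M} {x : M} : x ∈ pS p i U ↔ ∃ u ∈ U, p ^ i • u = x := by
  simp [pS, Submodule.mem_map]

lemma pS_mono {i : ℕ} {U V : Submodule R M} (h : U ≤ V) : pS p i U ≤ pS p i V :=
  Submodule.map_mono h

lemma pS_le {i : ℕ} {U : Submodule R M} : pS p i U ≤ U := by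
  intro x hx
  obtain ⟨u, hu, rfl⟩ := mem_pS.1 hx
  exact U.smul_mem _ hu

lemma pS_zero {U : Submodule R M} : pS p 0 U = U := by
  ext x; simp [mem_pS]

lemma pS_add {i j : ℕ} {U : Submodule R M} : pS p i (pS p j U) = pS p (i + j) U := by
  ext x; simp only [mem_pS]
  constructor
  · rintro ⟨_, ⟨v, hv, rfl⟩, rfl⟩
    exact ⟨v, hv, by rw [pow_add, mul_smul]⟩
  · rintro ⟨v, hv, rfl⟩
    exact ⟨_, ⟨v, hv, rfl⟩, by rw [pow_add, mul_smul]⟩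

lemma pS_sup {i : ℕ} {U V : Submodule R M} : pS p i (U ⊔ V) = pS p i U ⊔ pS p i V :=
  Submodule.map_sup _ _ _

lemma pS_antitone {U : Submodule R M} : Antitone (fun i => pS p i U) := by
  intro i j h
  obtain ⟨c, rfl⟩ := Nat.exists_eq_add_of_le h
  show pS p (i + c) U ≤ pS p i U
  rw [← pS_add]
  exact pS_mono pS_le

lemma pS_map (f : M →ₗ[R] N) (i : ℕ) (U : Submodule R M) :
    pS p i (U.map f) = (pS p i U).map f := by
  ext x
  simp only [mem_pS, Submodule.mem_map]
  constructor
  · rintro ⟨_, ⟨v, hv, rfl⟩, rfl⟩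
    exact ⟨_, ⟨v, hv, rfl⟩, by simp⟩
  · rintro ⟨_, ⟨v, hv, rfl⟩, rfl⟩
    exact ⟨_, ⟨v, hv, rfl⟩, by simp⟩

lemma card_map_inj (f : M →ₗ[R] N) (hf : Function.Injective f) (U : Submodule R M) :
    Nat.card (U.map f) = Nat.card U :=
  (Nat.card_congr (Submodule.equivMapOfInjective f hf U).toEquiv).symm

/-- card of `p^i U` computed in `U` or in `M`. -/
lemma card_pS_sub (U : Submodule R M) (i : ℕ) :
    Nat.card (pS p i (⊤ : Submodule R U)) = Nat.card (pS p i U) := by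
  rw [← card_map_inj U.subtype U.injective_subtype, ← pS_map, Submodule.map_top,
    Submodule.range_subtype]

lemma HT_sub {U : Submodule R M} {g : ℕ →₀ ℕ} :
    HT p U g ↔ ∀ i, Nat.card (pS p i U) = qq p ^ (g i) := by
  simp only [HT, card_pS_sub]

lemma HT_congr (e : M ≃ₗ[R] N) {g : ℕ →₀ ℕ} (h : HT p M g) : HT p N g := by
  intro i
  rw [← h i, ← card_map_inj e.toLinearMap e.injective, ← pS_map, Submodule.map_top,
    LinearEquiv.range]

lemma card_ker_range (f : M →ₗ[R] N) :
    Nat.card M = Nat.card (LinearMap.ker f) * Nat.card (LinearMap.range f) := by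
  rw [Submodule.card_eq_card_quotient_mul_card (LinearMap.ker f),
    Nat.card_congr f.quotKerEquivRange.toEquiv]

lemma card_inf_ker_map (f : M →ₗ[R] N) (X : Submodule R M) :
    Nat.card X = Nat.card (X ⊓ LinearMap.ker f : Submodule R M) * Nat.card (X.map f) := by
  rw [card_ker_range (f.domRestrict X)]
  congr 1
  · rw [← card_map_inj X.subtype X.injective_subtype]
    congr 2
    ext x
    simp [Submodule.mem_map, LinearMap.mem_ker, and_comm]
  · rw [LinearMap.range_domRestrict]

lemma card_le_map_mkQ {A X : Submodule R M} (h : A ≤ X) :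
    Nat.card X = Nat.card A * Nat.card (X.map A.mkQ) := by
  rw [card_inf_ker_map A.mkQ X, Submodule.ker_mkQ, inf_eq_right.2 h]

lemma card_sup_span (hp : (Ideal.span {p}).IsMaximal) {A : Submodule R M} {x : M}
    (hx : x ∉ A) (hpx : p • x ∈ A) :
    Nat.card (A ⊔ Submodule.span R {x} : Submodule R M) = Nat.card A * qq p := by
  rw [card_le_map_mkQ (A := A) le_sup_left]
  congr 1
  have h1 : (A ⊔ Submodule.span R {x}).map A.mkQ =
      LinearMap.range (LinearMap.toSpanSingleton R (M ⧸ A) (A.mkQ x)) := by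
    rw [Submodule.map_sup, Submodule.map_span, Set.image_singleton,
      LinearMap.range_toSpanSingleton]
    have : A.map A.mkQ = ⊥ := by
      exact Submodule.mkQ_map_self A
    rw [this, bot_sup_eq]
  have h2 : LinearMap.ker (LinearMap.toSpanSingleton R (M ⧸ A) (A.mkQ x)) = Ideal.span {p} := by
    symm
    apply hp.eq_of_le
    · intro h
      have : (1 : R) ∈ LinearMap.ker (LinearMap.toSpanSingleton R (M ⧸ A) (A.mkQ x)) := by
        rw [h]; trivial
      rw [LinearMap.mem_ker, LinearMap.toSpanSingleton_apply, one_smul] at this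
      exact hx (by simpa using this)
    · rw [Ideal.span_le, Set.singleton_subset_iff, SetLike.mem_coe, LinearMap.mem_ker,
        LinearMap.toSpanSingleton_apply, ← map_smul, Submodule.mkQ_apply,
        Submodule.Quotient.mk_eq_zero]
      exact hpx
  rw [h1, ← Nat.card_congr (LinearMap.quotKerEquivRange _).toEquiv, h2, qq]

lemma one_lt_qq (hp : (Ideal.span {p}).IsMaximal) [Finite (R ⧸ Ideal.span {p})] : 1 < qq p := by
  have : Nontrivial (R ⧸ Ideal.span {p}) := Ideal.Quotient.nontrivial_iff.2 hp.ne_top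
  exact Finite.one_lt_card

lemma exists_card_eq_pow (hp : (Ideal.span {p}).IsMaximal) (n c : ℕ) :
    ∀ (M : Type) [AddCommGroup M] [Module R M] [Finite M], (∀ x : M, p ^ n • x = 0) →
      Nat.card M ≤ c → ∃ j, Nat.card M = qq p ^ j := by
  induction c with
  | zero => 
    intro M _ _ _ _ h
    have : 0 < Nat.card M := Nat.card_pos
    omega
  | succ c ih =>
    intro M _ _ _ hn h
    by_cases hM : Subsingleton M
    · exact ⟨0, by simp⟩
    rw [not_subsingleton_iff_nontrivial] at hM
    obtain ⟨y, hy⟩ := exists_ne (0 : M)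
    have hex : ∃ j, p ^ j • y = 0 := ⟨n, hn y⟩
    classical
    obtain ⟨x, hx, hpx⟩ : ∃ x : M, x ≠ 0 ∧ p • x = 0 := by
      have h0 : Nat.find hex ≠ 0 := by
        intro h0
        have := Nat.find_spec hex
        rw [h0] at this
        simp at this; exact hy this
      obtain ⟨m, hm⟩ := Nat.exists_eq_succ_of_ne_zero h0
      refine ⟨p ^ m • y, Nat.find_min hex (by omega), ?_⟩
      have := Nat.find_spec hex
      rw [hm] at this
      rw [← mul_smul, ← pow_succ']
      exact this
    have h1 := card_sup_span hp (A := (⊥ : Submodule R M)) (x := x) (by simpa using hx) (by simpa using hpx)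
    rw [bot_sup_eq] at h1
    have h2 := Submodule.card_eq_card_quotient_mul_card (Submodule.span R {x})
    rw [h1] at h2
    have hb : Nat.card (⊥ : Submodule R M) = 1 := by simp
    rw [hb, one_mul] at h2
    have hq : 1 < qq p := by
      rcases Nat.lt_or_ge 1 (qq p) with h | h
      · exact h
      · exfalso
        have hs : Nat.card (Submodule.span R {x}) ≤ 1 := by rw [h1, hb]; omega
        have : Subsingleton (Submodule.span R {x}) := Finite.card_le_one_iff_subsingleton.1 hs
        have h3 := Subsingleton.elim (⟨x, Submodule.mem_span_singleton_self x⟩ : Submodule.span R {x}) 0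
        exact hx (congrArg Subtype.val h3)
    have hfin : Finite (M ⧸ Submodule.span R {x}) :=
      Finite.of_surjective _ (Submodule.mkQ_surjective (Submodule.span R {x}))
    have h4 : 0 < Nat.card (M ⧸ Submodule.span R {x}) := Nat.card_pos
    obtain ⟨j, hj⟩ := ih (M ⧸ Submodule.span R {x}) (by
      intro z
      obtain ⟨z, rfl⟩ := Submodule.mkQ_surjective _ z
      rw [← map_smul, hn, map_zero]) (by nlinarith)
    exact ⟨j + 1, by rw [h2, hj, pow_succ, mul_comm]⟩

lemma exists_HT (hp : (Ideal.span {p}).IsMaximal) [Finite M] {n : ℕ} (hn : ∀ x : M, p ^ n • x = 0) :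
    ∃ g, HT p M g := by
  have h : ∀ i, ∃ j, Nat.card (pS p i (⊤ : Submodule R M)) = qq p ^ j ∧ (n ≤ i → j = 0) := by
    intro i
    by_cases hi : n ≤ i
    · refine ⟨0, ?_, fun _ => rfl⟩
      have : pS p i (⊤ : Submodule R M) = ⊥ := by
        rw [eq_bot_iff]
        intro x hx
        obtain ⟨u, _, rfl⟩ := mem_pS.1 hx
        obtain ⟨c, rfl⟩ := Nat.exists_eq_add_of_le hi
        rw [add_comm, pow_add, mul_smul, hn]; simp
      rw [this]; simp
    · obtain ⟨j, hj⟩ := exists_card_eq_pow hp n _ (pS p i (⊤ : Submodule R M)) (by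
        rintro ⟨x, hx⟩; ext; simpa using hn x) le_rfl
      exact ⟨j, hj, fun h => absurd h hi⟩
  choose g hg using h
  refine ⟨Finsupp.onFinset (Finset.range n) g ?_, fun i => (hg i).1⟩
  intro i hi
  rw [Finset.mem_range]
  by_contra hc
  exact hi ((hg i).2 (by omega))

lemma HT_unique (hq : 1 < qq p) {g h : ℕ →₀ ℕ} (hg : HT p M g) (hh : HT p M h) : g = h := by
  ext i
  exact Nat.pow_right_injective hq ((hg i).symm.trans (hh i))

lemma HT_primary [Finite M] {g : ℕ →₀ ℕ} (hg : HT p M g) : ∃ n, ∀ x : M, p ^ n • x = 0 := by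
  obtain ⟨n, hn⟩ := g.support.exists_nat_subset_range
  refine ⟨n, fun x => ?_⟩
  have h0 : g n = 0 := by
    by_contra h
    have := hn (Finsupp.mem_support_iff.2 h)
    simp at this
  have h1 := hg n
  rw [h0, pow_zero] at h1
  have : Subsingleton (pS p n (⊤ : Submodule R M)) := Finite.card_le_one_iff_subsingleton.1 h1.le
  have h3 := Subsingleton.elim (⟨p ^ n • x, mem_pS.2 ⟨x, trivial, rfl⟩⟩ : pS p n (⊤ : Submodule R M)) 0
  exact congrArg Subtype.val h3

lemma card_le_of_le [Finite M] {U V : Submodule R M} (h : U ≤ V) : Nat.card U ≤ Nat.card V :=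
  Nat.card_le_card_of_injective _ (Submodule.inclusion_injective h)

lemma eq_of_le_card [Finite M] {U V : Submodule R M} (h : U ≤ V) (hc : Nat.card V ≤ Nat.card U) :
    U = V := by
  apply SetLike.coe_injective
  exact Set.eq_of_subset_of_ncard_le h hc (Set.toFinite _)

end core
end SegreHall

namespace SegreHall

section core
variable {R : Type} [CommRing R] {p : R}
variable {M : Type} [AddCommGroup M] [Module R M]

lemma card_fiber_sum {α β : Type*} [Finite α] [Fintype β] (f : α → β) :
    Nat.card α = ∑ b, Nat.card {a // f a = b} := by
  rw [← Nat.card_sigma]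
  exact Nat.card_congr (Equiv.sigmaFiberEquiv f).symm

lemma card_fiber_const {α β : Type*} [Finite α] [Finite β] (f : α → β) (c : ℕ)
    (h : ∀ b, Nat.card {a // f a = b} = c) : Nat.card α = Nat.card β * c := by
  have := Fintype.ofFinite β
  rw [card_fiber_sum f, Finset.sum_congr rfl (fun b _ => h b)]
  simp

lemma finite_submodule [Finite M] : Finite (Submodule R M) := inferInstance

lemma card_diff [Finite M] {A B : Submodule R M} (h : B ≤ A) :
    Nat.card {x : M // x ∈ A ∧ x ∉ B} + Nat.card B = Nat.card A := by
  have := Set.ncard_sdiff_add_ncard_of_subset (s := (B : Set M)) (t := (A : Set M)) h (Set.toFinite _)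
  exact this

lemma line_count (hp : (Ideal.span {p}).IsMaximal) [Finite (R ⧸ Ideal.span {p})] [Finite M]
    {A A0 W : Submodule R M} (hWA : W ≤ A0) (hA0 : A0 ≤ A) (hpA : ∀ x ∈ A, p • x ∈ W)
    (hc : Nat.card A = Nat.card A0 * qq p) :
    Nat.card {W' : Submodule R M // W' ≤ A ∧ W' ⊓ A0 = W ∧ Nat.card W' = Nat.card W * qq p}
      * Nat.card W = Nat.card A0 := by
  have hq := one_lt_qq hp
  have hinf : ∀ x ∈ A, x ∉ A0 → (W ⊔ Submodule.span R {x}) ⊓ A0 = W := by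
    intro x hxA hx
    apply le_antisymm
    · rintro y ⟨hy, hy0⟩
      obtain ⟨w, hw, z, hz, rfl⟩ := Submodule.mem_sup.1 hy
      obtain ⟨r, rfl⟩ := Submodule.mem_span_singleton.1 hz
      have hr : r • x ∈ A0 := by
        have := A0.sub_mem hy0 (hWA hw)
        simpa using this
      have hrp : r ∈ Ideal.span {p} := by
        by_contra hrp
        obtain ⟨s, hs⟩ := hp.exists_inv hrp
        obtain ⟨t', h1, h2⟩ := hs
        obtain ⟨u, rfl⟩ := Ideal.mem_span_singleton'.1 h1
        apply hx
        have : x = s • (r • x) + u • (p • x) := by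
          rw [← mul_smul, ← mul_smul, ← add_smul, h2, one_smul]
        rw [this]
        exact A0.add_mem (A0.smul_mem _ hr) (A0.smul_mem _ (hWA (hpA x hxA)))
      obtain ⟨u, rfl⟩ := Ideal.mem_span_singleton'.1 hrp
      refine W.add_mem hw ?_
      rw [mul_smul]
      exact W.smul_mem _ (hpA x hxA)
    · exact le_inf le_sup_left hWA
  let S := {W' : Submodule R M // W' ≤ A ∧ W' ⊓ A0 = W ∧ Nat.card W' = Nat.card W * qq p}
  let f : {x : M // x ∈ A ∧ x ∉ A0} → S := fun x =>
    ⟨W ⊔ Submodule.span R {x.1}, sup_le (hWA.trans hA0) (by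
        rw [Submodule.span_le]; simpa using x.2.1), hinf _ x.2.1 x.2.2,
      card_sup_span hp (fun h => x.2.2 (hWA h)) (hpA _ x.2.1)⟩
  have hfib : ∀ b : S, Nat.card {a // f a = b} = Nat.card W * qq p - Nat.card W := by
    rintro ⟨W', h1, h2, h3⟩
    have hWW : W ≤ W' := by rw [← h2]; exact inf_le_left
    have := card_diff hWW
    rw [h3] at this
    refine Eq.trans ?_ (Nat.eq_sub_of_add_eq this)
    refine Nat.card_congr ⟨fun a => ⟨a.1.1, ?_⟩, fun x => ⟨⟨x.1, ?_⟩, ?_⟩, fun _ => rfl, fun _ => rfl⟩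
    · have ha := congrArg Subtype.val a.2
      refine ⟨?_, fun h => a.1.2.2 (hWA h)⟩
      change W ⊔ Submodule.span R {a.1.1} = W' at ha
      exact ha.le (Submodule.mem_sup_right (Submodule.mem_span_singleton_self _))
    · refine ⟨h1 x.2.1, fun h => x.2.2 ?_⟩
      exact h2.le ⟨x.2.1, h⟩
    · apply Subtype.ext
      change W ⊔ Submodule.span R {x.1} = W'
      apply eq_of_le_card
      · exact sup_le hWW (by rw [Submodule.span_le]; simpa using x.2.1)
      · rw [card_sup_span hp x.2.2 (hpA _ (h1 x.2.1)), h3]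
  have h1 := card_fiber_const f _ hfib
  have h2 := card_diff hA0
  rw [hc, h1] at h2
  obtain ⟨c, hcq⟩ := Nat.exists_eq_add_of_lt hq
  have h3 : Nat.card W * qq p - Nat.card W = Nat.card W * (c + 1) := by
    rw [hcq, show 1 + c + 1 = (c + 1) + 1 from by ring, mul_add, mul_one, Nat.add_sub_cancel]
  rw [h3, hcq] at h2
  have h4 : (Nat.card S * Nat.card W) * (c + 1) = Nat.card A0 * (c + 1) := by nlinarith
  exact Nat.eq_of_mul_eq_mul_right (Nat.succ_pos c) h4

lemma exists_hyperplane (hp : (Ideal.span {p}).IsMaximal) [Finite M]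
    {A B : Submodule R M} (h : B < A) (hpA : ∀ x ∈ A, p • x ∈ B) :
    ∃ A0, B ≤ A0 ∧ A0 ≤ A ∧ Nat.card A = Nat.card A0 * qq p := by
  obtain ⟨A0, hm⟩ := Set.Finite.exists_maximal (s := {C : Submodule R M | B ≤ C ∧ C < A})
    (Set.toFinite _) ⟨B, le_rfl, h⟩
  obtain ⟨⟨h1, h2⟩, h3⟩ := hm
  refine ⟨A0, h1, h2.le, ?_⟩
  obtain ⟨x, hxA, hx⟩ := SetLike.exists_of_lt h2
  rw [← card_sup_span hp hx (h1 (hpA x hxA))]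
  have hle : A0 ⊔ Submodule.span R {x} ≤ A := sup_le h2.le (by
    rw [Submodule.span_le]; simpa using hxA)
  rcases hle.lt_or_eq with hlt | heq
  · exfalso
    have := h3 (⟨h1.trans le_sup_left, hlt⟩ : _ ∧ _) le_sup_left
    exact hx (this (Submodule.mem_sup_right (Submodule.mem_span_singleton_self _)))
  · rw [heq]

lemma fiber_poly (m : ℕ) : ∀ b w c : ℕ, ∃ P : Polynomial ℤ, ∀ (R : Type) [CommRing R] (p : R)
    (_ : (Ideal.span {p}).IsMaximal) [Finite (R ⧸ Ideal.span {p})] (M : Type) [AddCommGroup M]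
    [Module R M] [Finite M] (A B W : Submodule R M), W ≤ B → B ≤ A → (∀ x ∈ A, p • x ∈ W) →
    Nat.card W = qq p ^ w → Nat.card B = qq p ^ b → Nat.card A = qq p ^ (b + m) →
    (Nat.card {W' : Submodule R M // W' ≤ A ∧ W' ⊓ B = W ∧ Nat.card W' = qq p ^ c} : ℤ) =
      P.eval (qq p : ℤ) := by
  induction m with
  | zero =>
    intro b w c
    refine ⟨if w = c then 1 else 0, ?_⟩
    intro R _ p hp _ M _ _ _ A B W hWB hBA hpA hW hB hA
    have hq := one_lt_qq hp
    have hBA' : B = A := eq_of_le_card hBA (by rw [hA, hB]; simp)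
    subst hBA'
    split_ifs with h
    · subst h
      simp only [eval_one, Nat.cast_eq_one]
      rw [Nat.card_eq_one_iff_unique]
      refine ⟨⟨fun x y => ?_⟩, ⟨⟨W, hWB, inf_eq_left.2 hWB, hW⟩⟩⟩
      have h1 := x.2.2.1
      have h2 := y.2.2.1
      rw [inf_eq_left.2 x.2.1] at h1
      rw [inf_eq_left.2 y.2.1] at h2
      exact Subtype.ext (h1.trans h2.symm)
    · simp only [eval_zero, Nat.cast_eq_zero, Nat.card_eq_zero]
      left
      refine ⟨fun x => h ?_⟩
      have h1 := x.2.2.1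
      rw [inf_eq_left.2 x.2.1] at h1
      have h2 := x.2.2.2
      rw [h1, hW] at h2
      exact Nat.pow_right_injective hq h2
  | succ m ih =>
    intro b w c
    obtain ⟨P1, hP1⟩ := ih b w c
    obtain ⟨P2, hP2⟩ := ih b w (c - 1)
    refine ⟨P1 + if c = 0 then 0 else X ^ (b + m - (c - 1)) * P2, ?_⟩
    intro R _ p hp _ M _ _ _ A B W hWB hBA hpA hW hB hA
    have hq := one_lt_qq hp
    have hlt : B < A := by
      refine lt_of_le_of_ne hBA ?_
      rintro rfl
      rw [hB] at hA
      have := Nat.pow_right_injective hq hA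
      omega
    obtain ⟨A0, hBA0, hA0A, hcard⟩ := exists_hyperplane hp hlt (fun x hx => hWB (hpA x hx))
    have hcA0 : Nat.card A0 = qq p ^ (b + m) := by
      rw [hA, ← add_assoc, pow_succ] at hcard
      exact (Nat.eq_of_mul_eq_mul_right (by omega) hcard).symm
    let S := {W' : Submodule R M // W' ≤ A ∧ W' ⊓ B = W ∧ Nat.card W' = qq p ^ c}
    let S1 := {W' : Submodule R M // W' ≤ A0 ∧ W' ⊓ B = W ∧ Nat.card W' = qq p ^ c}
    let S2 := {W' : Submodule R M // W' ≤ A0 ∧ W' ⊓ B = W ∧ Nat.card W' = qq p ^ (c - 1)}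
    have h1 : Nat.card S1 = P1.eval (qq p : ℤ) :=
      hP1 R p hp M A0 B W hWB hBA0 (fun x hx => hpA x (hA0A hx)) hW hB hcA0
    have h2 : Nat.card S2 = P2.eval (qq p : ℤ) :=
      hP2 R p hp M A0 B W hWB hBA0 (fun x hx => hpA x (hA0A hx)) hW hB hcA0
    have hsplit : Nat.card S = Nat.card S1 + Nat.card {s : S // ¬ s.1 ≤ A0} := by
      classical
      rw [← Nat.card_congr (Equiv.sumCompl (fun s : S => s.1 ≤ A0)), Nat.card_sum]
      congr 1
      exact Nat.card_congr ⟨fun s => ⟨s.1.1, s.2, s.1.2.2⟩, fun s => ⟨⟨s.1, s.2.1.trans hA0A, s.2.2⟩, s.2.1⟩,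
        fun _ => rfl, fun _ => rfl⟩
    have hstep : ∀ W' : Submodule R M, W' ≤ A → W ≤ W' → ¬ W' ≤ A0 →
        Nat.card W' = Nat.card (W' ⊓ A0 : Submodule R M) * qq p := by
      intro W' h1 h2 h3
      obtain ⟨x, hxW, hx⟩ := SetLike.not_le_iff_exists.1 h3
      have hpx : p • x ∈ W' ⊓ A0 := ⟨h2 (hpA x (h1 hxW)), hBA0 (hWB (hpA x (h1 hxW)))⟩
      rw [← card_sup_span hp (fun h => hx (Submodule.mem_inf.1 h).2) hpx]
      have e1 : A0 ⊔ Submodule.span R {x} = A := by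
        apply eq_of_le_card
        · exact sup_le hA0A (by rw [Submodule.span_le]; simpa using h1 hxW)
        · rw [card_sup_span hp hx hpx.2, hcard]
      have e2 : (W' ⊓ A0) ⊔ Submodule.span R {x} = W' := by
        rw [inf_sup_assoc_of_le A0 (show Submodule.span R {x} ≤ W' by
          rw [Submodule.span_le]; simpa using hxW), e1]
        exact inf_eq_left.2 h1
      rw [e2]
    change ((Nat.card S : ℕ) : ℤ) = _
    rw [hsplit]
    push_cast
    rw [h1, eval_add]
    congr 1
    split_ifs with hc0
    · subst hc0
      simp only [eval_zero, Nat.cast_eq_zero, Nat.card_eq_zero]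
      left
      refine ⟨?_⟩
      rintro ⟨⟨s, s1, s2, s3⟩, s4⟩
      have e := hstep s s1 (s2.symm.le.trans inf_le_left) s4
      rw [s3, pow_zero] at e
      have := Nat.eq_one_of_mul_eq_one_left e.symm
      omega
    · obtain ⟨c, rfl⟩ := Nat.exists_eq_succ_of_ne_zero hc0
      have hWW : ∀ s : S, W ≤ s.1 := fun s => s.2.2.1.symm.le.trans inf_le_left
      let f : {s : S // ¬ s.1 ≤ A0} → S2 := fun s => ⟨s.1.1 ⊓ A0, inf_le_right, by
          rw [inf_assoc, inf_eq_right.2 hBA0, s.1.2.2.1], by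
          have e := hstep s.1.1 s.1.2.1 (hWW s.1) s.2
          obtain ⟨⟨s, s1, s2, s3⟩, s4⟩ := s
          change Nat.card s = Nat.card (s ⊓ A0 : Submodule R M) * qq p at e
          rw [s3, Nat.succ_eq_add_one, pow_succ] at e
          exact (Nat.eq_of_mul_eq_mul_right (by omega) e).symm⟩
      have hfib : ∀ t : S2, Nat.card {s // f s = t} = qq p ^ (b + m - c) := by
        rintro ⟨W'', t1, t2, t3⟩
        have hW'' : W ≤ W'' := by rw [← t2]; exact inf_le_left
        have l := line_count hp (W := W'') t1 hA0A (fun x hx => hW'' (hpA x hx)) hcard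
        have hcle : c ≤ b + m := by
          have := card_le_of_le t1
          rw [t3, hcA0] at this
          have := (Nat.pow_le_pow_iff_right hq).1 this
          simpa using this
        have hpow : qq p ^ (b + m) = qq p ^ (b + m - c) * qq p ^ c := by
          rw [← pow_add]; congr 1; omega
        rw [hcA0, hpow] at l
        rw [t3] at l
        have l' := Nat.eq_of_mul_eq_mul_right (Nat.pow_pos (by omega)) l
        rw [← l']
        refine Nat.card_congr ⟨fun s => ⟨s.1.1.1, s.1.1.2.1, congrArg Subtype.val s.2, ?_⟩,
          fun s => ⟨⟨⟨s.1, s.2.1, ?_, ?_⟩, ?_⟩, ?_⟩, fun _ => rfl, fun _ => rfl⟩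
        · rw [s.1.1.2.2.2]; simp [pow_succ]
        · rw [← t2, ← congrArg (· ⊓ B) s.2.2.1]; simp only [inf_assoc, inf_eq_right.2 hBA0]
        · rw [s.2.2.2]; simp [pow_succ]
        · intro hle
          have e := s.2.2.1
          rw [inf_eq_left.2 hle] at e
          have e2 := s.2.2.2
          have e2 := (congrArg (fun Z : Submodule R M => Nat.card Z) e).symm.trans e2
          rw [t3] at e2
          have h0 : 0 < qq p ^ c := Nat.pow_pos (by omega)
          simp at e2
          nlinarith
        · exact Subtype.ext s.2.2.1
      have h3 := card_fiber_const f _ hfib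
      rw [h3]
      push_cast
      rw [h2]
      simp [mul_comm]

end core
end SegreHall

namespace SegreHall

section core
variable {R : Type} [CommRing R] {p : R}
variable {M : Type} [AddCommGroup M] [Module R M]

lemma flag_poly (n : ℕ) (k w : ℕ → ℕ) : ∃ P : Polynomial ℤ, ∀ (R : Type) [CommRing R] (p : R)
    (_ : (Ideal.span {p}).IsMaximal) [Finite (R ⧸ Ideal.span {p})] (M : Type) [AddCommGroup M]
    [Module R M] [Finite M] (K : ℕ → Submodule R M), Monotone K → (∀ x ∈ K n, p • x ∈ K 0) →
    (∀ i ≤ n, Nat.card (K i) = qq p ^ (k i)) →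
    (Nat.card {W : Submodule R M // K 0 ≤ W ∧ W ≤ K n ∧
      ∀ i ≤ n, Nat.card (W ⊓ K i : Submodule R M) = qq p ^ (w i)} : ℤ) =
      P.eval (qq p : ℤ) := by
  induction n with
  | zero =>
    refine ⟨if w 0 = k 0 then 1 else 0, ?_⟩
    intro R _ p hp _ M _ _ _ K hK hpK hk
    have hq := one_lt_qq hp
    split_ifs with h
    · simp only [eval_one, Nat.cast_eq_one]
      rw [Nat.card_eq_one_iff_unique]
      refine ⟨⟨fun x y => ?_⟩, ⟨⟨K 0, le_rfl, le_rfl, ?_⟩⟩⟩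
      · exact Subtype.ext ((le_antisymm x.2.2.1 x.2.1).trans (le_antisymm y.2.2.1 y.2.1).symm)
      · intro i hi
        obtain rfl : i = 0 := by omega
        rw [inf_idem, hk 0 le_rfl, h]
    · simp only [eval_zero, Nat.cast_eq_zero, Nat.card_eq_zero]
      left
      refine ⟨?_⟩
      rintro ⟨x, h1, h2, h3⟩
      have e : x = K 0 := le_antisymm h2 h1
      have := h3 0 le_rfl
      rw [e, inf_idem, hk 0 le_rfl] at this
      exact h (Nat.pow_right_injective hq this).symm
  | succ n ih =>
    obtain ⟨P1, hP1⟩ := ih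
    obtain ⟨P2, hP2⟩ := fiber_poly (k (n + 1) - k n) (k n) (w n) (w (n + 1))
    refine ⟨P1 * P2, ?_⟩
    intro R _ p hp _ M _ _ _ K hK hpK hk
    have hq := one_lt_qq hp
    have h1 := hP1 R p hp M K hK (fun x hx => hpK x (hK (Nat.le_succ n) hx))
      (fun i hi => hk i (by omega))
    have hkk : k n ≤ k (n + 1) := by
      have := card_le_of_le (hK (Nat.le_succ n))
      rw [hk n (by omega), hk (n + 1) le_rfl] at this
      exact (Nat.pow_le_pow_iff_right hq).1 this
    let S := {W : Submodule R M // K 0 ≤ W ∧ W ≤ K n ∧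
      ∀ i ≤ n, Nat.card (W ⊓ K i : Submodule R M) = qq p ^ (w i)}
    let S' := {W : Submodule R M // K 0 ≤ W ∧ W ≤ K (n + 1) ∧
      ∀ i ≤ n + 1, Nat.card (W ⊓ K i : Submodule R M) = qq p ^ (w i)}
    let f : S' → S := fun s => ⟨s.1 ⊓ K n, le_inf s.2.1 (hK (Nat.zero_le n)), inf_le_right, by
      intro i hi
      rw [inf_assoc, inf_eq_right.2 (hK hi)]
      exact s.2.2.2 i (by omega)⟩
    by_cases hS : IsEmpty S
    · have hS' : IsEmpty S' := ⟨fun s => hS.false (f s)⟩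
      have e1 : Nat.card S = 0 := Nat.card_eq_zero.2 (Or.inl hS)
      have e2 : Nat.card S' = 0 := Nat.card_eq_zero.2 (Or.inl hS')
      change ((Nat.card S : ℕ) : ℤ) = _ at h1
      change ((Nat.card S' : ℕ) : ℤ) = _
      rw [e2, eval_mul, ← h1, e1]; simp
    have hfib' : ∀ t : S, (Nat.card {s // f s = t} : ℤ) = P2.eval (qq p : ℤ) := by
      rintro ⟨W, t1, t2, t3⟩
      have hW : Nat.card W = qq p ^ w n := by
        have := t3 n le_rfl
        rwa [inf_eq_left.2 t2] at this
      rw [← hP2 R p hp M (K (n + 1)) (K n) W t2 (hK (Nat.le_succ n))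
        (fun x hx => t1 (hpK x hx)) hW (hk n (by omega)) (by rw [hk (n + 1) le_rfl]; congr 1; omega)]
      congr 1
      refine Nat.card_congr ⟨fun s => ⟨s.1.1, s.1.2.2.1, congrArg Subtype.val s.2, ?_⟩,
          fun s => ⟨⟨s.1, ?_, s.2.1, ?_⟩, ?_⟩, fun _ => rfl, fun _ => rfl⟩
      · obtain ⟨⟨s, s1, s2, s3⟩, s4⟩ := s
        have := s3 (n + 1) le_rfl
        rwa [inf_eq_left.2 s2] at this
      · exact t1.trans (s.2.2.1.symm.le.trans inf_le_left)
      · obtain ⟨s, s1, s2, s3⟩ := s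
        intro i hi
        rcases Nat.lt_or_ge n i with h | h
        · obtain rfl : i = n + 1 := by omega
          change Nat.card (s ⊓ K (n + 1) : Submodule R M) = _
          rw [inf_eq_left.2 s1, s3]
        · have := t3 i h
          rw [← s2, inf_assoc, inf_eq_right.2 (hK h)] at this
          exact this
      · exact Subtype.ext s.2.2.1
    rw [not_isEmpty_iff] at hS
    obtain ⟨t0⟩ := hS
    have h3 := card_fiber_const f (Nat.card {s // f s = t0}) (by
      intro b
      exact_mod_cast (hfib' b).trans (hfib' t0).symm)
    change ((Nat.card S' : ℕ) : ℤ) = _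
    change ((Nat.card S : ℕ) : ℤ) = _ at h1
    rw [h3, eval_mul, ← h1, ← hfib' t0]
    push_cast
    rfl

lemma elem_card [Finite M] {X : Submodule R M} (hX : pS p 1 ⊤ ≤ X) (i : ℕ) :
    Nat.card X * Nat.card (pS p (i + 1) (⊤ : Submodule R M)) =
    Nat.card (pS p i X) *
      Nat.card (X ⊓ (pS p (i + 1) ⊤).comap (LinearMap.lsmul R M (p ^ i)) : Submodule R M) := by
  have hle : pS p (i + 1) (⊤ : Submodule R M) ≤ pS p i X := by
    rw [← pS_add]; exact pS_mono hX
  have h1 := card_le_map_mkQ hle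
  have h2 := card_inf_ker_map ((pS p (i + 1) (⊤ : Submodule R M)).mkQ ∘ₗ LinearMap.lsmul R M (p ^ i)) X
  rw [LinearMap.ker_comp, Submodule.ker_mkQ, Submodule.map_comp] at h2
  change Nat.card (pS p i X) = _ * Nat.card (Submodule.map _ (X.map (LinearMap.lsmul R M (p ^ i)))) at h1
  rw [h1, h2]
  ring

lemma elem_poly (l m : ℕ →₀ ℕ) : ∃ P : Polynomial ℤ, ∀ (R : Type) [CommRing R] (p : R)
    (_ : (Ideal.span {p}).IsMaximal) [Finite (R ⧸ Ideal.span {p})] (M : Type) [AddCommGroup M]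
    [Module R M] [Finite M], HT p M l →
    (Nat.card {X : Submodule R M // pS p 1 ⊤ ≤ X ∧ HT p X m} : ℤ) = P.eval (qq p : ℤ) := by
  obtain ⟨n1, hn1⟩ := l.support.exists_nat_subset_range
  obtain ⟨n2, hn2⟩ := m.support.exists_nat_subset_range
  have hl : ∀ i, n1 ≤ i → l i = 0 := by
    intro i hi
    by_contra h
    have := hn1 (Finsupp.mem_support_iff.2 h)
    simp at this; omega
  have hm : ∀ i, n2 ≤ i → m i = 0 := by
    intro i hi
    by_contra h
    have := hn2 (Finsupp.mem_support_iff.2 h)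
    simp at this; omega
  set n := max n1 n2 with hn
  by_cases hbad : ∀ i, m i ≤ m 0 + l (i + 1)
  swap
  · refine ⟨0, ?_⟩
    intro R _ p hp _ M _ _ _ hM
    have hq := one_lt_qq hp
    simp only [eval_zero, Nat.cast_eq_zero, Nat.card_eq_zero]
    left
    refine ⟨?_⟩
    rintro ⟨X, h1, h2⟩
    rw [HT_sub] at h2
    apply hbad
    intro i
    have h3 := elem_card h1 i
    have h4 : Nat.card X = qq p ^ (m 0) := by rw [← h2 0, pS_zero]
    rw [h4, hM (i + 1), h2 i, ← pow_add] at h3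
    have h5 : qq p ^ (m i) ≤ qq p ^ (m 0 + l (i + 1)) := by
      rw [h3]
      exact Nat.le_mul_of_pos_right _ Nat.card_pos
    exact (Nat.pow_le_pow_iff_right hq).1 h5
  obtain ⟨P, hP⟩ := flag_poly n (fun i => l 0 + l (i + 1) - l i) (fun i => m 0 + l (i + 1) - m i)
  refine ⟨P, ?_⟩
  intro R _ p hp _ M _ _ _ hM
  have hq := one_lt_qq hp
  let K : ℕ → Submodule R M := fun i => (pS p (i + 1) ⊤).comap (LinearMap.lsmul R M (p ^ i))
  have hK0 : K 0 = pS p 1 ⊤ := by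
    ext x; simp [K]
  have hKn : K n = ⊤ := by
    have h0 : pS p n (⊤ : Submodule R M) = ⊥ := by
      have := hM n
      rw [hl n (by omega), pow_zero] at this
      have hs : Subsingleton (pS p n (⊤ : Submodule R M)) :=
        Finite.card_le_one_iff_subsingleton.1 this.le
      exact Submodule.eq_bot_of_subsingleton
    rw [eq_top_iff]
    intro x _
    have hx : p ^ n • x ∈ pS p n (⊤ : Submodule R M) := mem_pS.2 ⟨x, trivial, rfl⟩
    rw [h0, Submodule.mem_bot] at hx
    simp [K, hx]
  have hmono : Monotone K := by
    apply monotone_nat_of_le_succ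
    intro i x hx
    simp only [K, Submodule.mem_comap, LinearMap.lsmul_apply, mem_pS] at hx ⊢
    obtain ⟨u, hu, hu'⟩ := hx
    exact ⟨u, hu, by rw [pow_succ' p (i + 1), mul_smul, hu', ← mul_smul, ← pow_succ']⟩
  have hpow : ∀ a b c d: ℕ, qq p ^ a * qq p ^ b = qq p ^ c * d → d = qq p ^ (a + b - c) := by
    intro a b c d h
    rw [← pow_add] at h
    have hd : 0 < d := by
      rcases Nat.eq_zero_or_pos d with h0 | h0
      · rw [h0, mul_zero] at h
        have : 0 < qq p ^ (a + b) := Nat.pow_pos (by omega)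
        omega
      · exact h0
    have hle : c ≤ a + b := by
      apply (Nat.pow_le_pow_iff_right hq).1
      rw [h]; exact Nat.le_mul_of_pos_right _ hd
    have e : qq p ^ (a + b) = qq p ^ c * qq p ^ (a + b - c) := by
      rw [← pow_add]; congr 1; omega
    rw [e] at h
    exact (Nat.eq_of_mul_eq_mul_left (Nat.pow_pos (by omega)) h).symm
  have hKc : ∀ i, Nat.card (K i) = qq p ^ (l 0 + l (i + 1) - l i) := by
    intro i
    have h3 := elem_card (p := p) (X := (⊤ : Submodule R M)) le_top i
    have h4 : Nat.card (⊤ : Submodule R M) = qq p ^ (l 0) := by rw [← hM 0, pS_zero]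
    rw [h4, hM (i + 1), hM i, top_inf_eq] at h3
    exact hpow _ _ _ _ h3
  rw [← hP R p hp M K hmono (by
    intro x _
    rw [hK0]
    exact mem_pS.2 ⟨x, trivial, by simp⟩) (fun i _ => hKc i)]
  congr 1
  apply Nat.card_congr
  apply Equiv.subtypeEquivRight
  intro X
  rw [hK0, hKn]
  simp only [le_top, true_and]
  apply and_congr_right
  intro hX
  rw [HT_sub]
  constructor
  · intro h i _
    have h3 := elem_card hX i
    have h4 : Nat.card X = qq p ^ (m 0) := by rw [← h 0, pS_zero]
    rw [h4, hM (i + 1), h i] at h3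
    exact hpow _ _ _ _ h3
  · intro h
    have hc : Nat.card X = qq p ^ (m 0) := by
      have := h n le_rfl
      rw [hKn, inf_top_eq, hl (n + 1) (by omega), hm n (by omega)] at this
      simpa using this
    intro i
    rcases Nat.lt_or_ge n i with hi | hi
    · have e : Nat.card (pS p i (⊤ : Submodule R M)) = 1 := by
        rw [hM i, hl i (by omega), pow_zero]
      have := card_le_of_le (pS_mono (p := p) (i := i) (le_top : X ≤ ⊤))
      have h0 : 0 < Nat.card (pS p i X) := Nat.card_pos
      rw [hm i (by omega), pow_zero]
      omega
    · have h3 := elem_card hX i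
      have h4 := h i hi
      simp only [K] at h4
      rw [hc, hM (i + 1), h4, ← pow_add] at h3
      have h5 : qq p ^ (m 0 + l (i + 1)) = qq p ^ (m i) * qq p ^ (m 0 + l (i + 1) - m i) := by
        rw [← pow_add]; congr 1; have := hbad i; omega
      rw [h5] at h3
      exact (Nat.eq_of_mul_eq_mul_right (Nat.pow_pos (by omega)) h3).symm

end core
end SegreHall

namespace SegreHall

lemma sum_by_type {ι κ : Type*} [Fintype ι] [DecidableEq κ] (t : ι → κ) (s : Finset κ)
    (F : κ → ℤ) (h : ∀ i, t i ∉ s → F (t i) = 0) :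
    ∑ i, F (t i) = ∑ y ∈ s, (Nat.card {i // t i = y} : ℤ) * F y := by
  have h1 : ∑ i, F (t i) = ∑ i, ∑ y ∈ s, if t i = y then F y else 0 := by
    apply Finset.sum_congr rfl
    intro i _
    rw [Finset.sum_ite_eq]
    split_ifs with hi
    · rfl
    · exact h i hi
  rw [h1, Finset.sum_comm]
  apply Finset.sum_congr rfl
  intro y _
  rw [← Finset.sum_filter, Finset.sum_const, nsmul_eq_mul, Nat.card_eq_fintype_card,
    Fintype.card_subtype]

section core
variable {R : Type} [CommRing R] {p : R}
variable {M : Type} [AddCommGroup M] [Module R M]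

open Classical in
/-- the length sequence of a module -/
noncomputable def ty (p : R) (M : Type) [AddCommGroup M] [Module R M] : ℕ →₀ ℕ :=
  if h : ∃ g, HT p M g then h.choose else 0

lemma ty_eq (hq : 1 < qq p) {g : ℕ →₀ ℕ} (h : HT p M g) : ty p M = g := by
  have h' : ∃ g, HT p M g := ⟨g, h⟩
  rw [ty, dif_pos h']
  exact HT_unique hq h'.choose_spec h

lemma HT_ty {g : ℕ →₀ ℕ} (h : HT p M g) : HT p M (ty p M) := by
  have h' : ∃ g, HT p M g := ⟨g, h⟩
  rw [ty, dif_pos h']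
  exact h'.choose_spec

lemma HT_ty_sub (hp : (Ideal.span {p}).IsMaximal) [Finite M] {g : ℕ →₀ ℕ} (h : HT p M g)
    (U : Submodule R M) : HT p U (ty p U) := by
  obtain ⟨n, hn⟩ := HT_primary h
  obtain ⟨g', hg'⟩ := exists_HT (M := U) hp (n := n) (by
    rintro ⟨x, hx⟩; ext; simpa using hn x)
  exact HT_ty hg'

lemma HT_ty_quot (hp : (Ideal.span {p}).IsMaximal) [Finite M] {g : ℕ →₀ ℕ} (h : HT p M g)
    (U : Submodule R M) : HT p (M ⧸ U) (ty p (M ⧸ U)) := by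
  obtain ⟨n, hn⟩ := HT_primary h
  have hfin : Finite (M ⧸ U) := Finite.of_surjective _ (Submodule.mkQ_surjective U)
  obtain ⟨g', hg'⟩ := exists_HT (M := M ⧸ U) hp (n := n) (by
    intro z
    obtain ⟨z, rfl⟩ := Submodule.mkQ_surjective _ z
    rw [← map_smul, hn, map_zero])
  exact HT_ty hg'

lemma HT_sub_le (hq : 1 < qq p) [Finite M] {g h : ℕ →₀ ℕ} (hM : HT p M g)
    {U : Submodule R M} (hU : HT p U h) : h ≤ g := by
  intro i
  rw [HT_sub] at hU
  apply (Nat.pow_le_pow_iff_right hq).1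
  rw [← hU i, ← hM i]
  exact card_le_of_le (pS_mono le_top)

lemma pS_quot_top (U : Submodule R M) (i : ℕ) :
    pS p i (⊤ : Submodule R (M ⧸ U)) = (pS p i ⊤).map U.mkQ := by
  rw [← pS_map, Submodule.map_top, Submodule.range_mkQ]

lemma HT_quot_le (hq : 1 < qq p) [Finite M] {g h : ℕ →₀ ℕ} (hM : HT p M g)
    {U : Submodule R M} (hU : HT p (M ⧸ U) h) : h ≤ g := by
  intro i
  apply (Nat.pow_le_pow_iff_right hq).1
  rw [← hU i, ← hM i, pS_quot_top, card_inf_ker_map U.mkQ (pS p i ⊤)]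
  exact Nat.le_mul_of_pos_left _ Nat.card_pos

lemma HT_add_zero (hq : 1 < qq p) {l a b : ℕ →₀ ℕ} (hM : HT p M l)
    {U : Submodule R M} (hU : HT p U a) (hQ : HT p (M ⧸ U) b) : l 0 = a 0 + b 0 := by
  apply Nat.pow_right_injective hq
  have h1 := hM 0
  have h2 := hU 0
  have h3 := hQ 0
  rw [pS_zero] at h1 h2 h3
  simp only [pow_add]
  rw [← h1, ← h2, ← h3]
  have := Submodule.card_eq_card_quotient_mul_card U
  rw [Nat.card_congr Submodule.topEquiv.toEquiv, Nat.card_congr Submodule.topEquiv.toEquiv,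
    Nat.card_congr Submodule.topEquiv.toEquiv, this, mul_comm]

/-- fibre count 1 -/
lemma count_left {α β : ℕ →₀ ℕ} (X : Submodule R M) :
    Nat.card {U : Submodule R M // U ≤ X ∧ HT p U α ∧ HT p (X.map U.mkQ) β} =
    Nat.card {U : Submodule R X // HT p U α ∧ HT p (X ⧸ U) β} := by
  symm
  have key : ∀ U : Submodule R X, Nonempty ((X ⧸ U) ≃ₗ[R] (X.map (U.map X.subtype).mkQ)) := by
    intro U
    have h1 : U = LinearMap.ker ((U.map X.subtype).mkQ ∘ₗ X.subtype) := by
      rw [LinearMap.ker_comp, Submodule.ker_mkQ, Submodule.comap_map_eq_of_injective X.injective_subtype]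
    have h2 : LinearMap.range ((U.map X.subtype).mkQ ∘ₗ X.subtype) = X.map (U.map X.subtype).mkQ := by
      rw [LinearMap.range_comp, Submodule.range_subtype]
    exact ⟨(Submodule.quotEquivOfEq _ _ h1).trans
      ((LinearMap.quotKerEquivRange _).trans (LinearEquiv.ofEq _ _ h2))⟩
  have key2 : ∀ U : Submodule R X, (HT p U α ∧ HT p (X ⧸ U) β) ↔
      (HT p (U.map X.subtype) α ∧ HT p (X.map (U.map X.subtype).mkQ) β) := by
    intro U
    obtain ⟨e⟩ := key U
    let e2 := Submodule.equivMapOfInjective X.subtype X.injective_subtype U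
    exact ⟨fun h => ⟨HT_congr e2 h.1, HT_congr e h.2⟩,
      fun h => ⟨HT_congr e2.symm h.1, HT_congr e.symm h.2⟩⟩
  refine Nat.card_congr (Equiv.ofBijective (fun U => ⟨U.1.map X.subtype,
    Submodule.map_subtype_le _ _, (key2 U.1).1 U.2⟩) ⟨?_, ?_⟩)
  · intro U V h
    apply Subtype.ext
    exact Submodule.map_injective_of_injective X.injective_subtype (congrArg Subtype.val h)
  · rintro ⟨U, hU, h⟩
    have e : (U.comap X.subtype).map X.subtype = U := by
      rw [Submodule.map_comap_subtype, inf_eq_right.2 hU]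
    refine ⟨⟨U.comap X.subtype, ?_⟩, Subtype.ext e⟩
    rw [key2, e]
    exact h

/-- fibre count 2 -/
lemma count_right {β : ℕ →₀ ℕ} (U : Submodule R M) :
    Nat.card {X : Submodule R M // U ≤ X ∧ pS p 1 ⊤ ≤ X ∧ HT p (X.map U.mkQ) β} =
    Nat.card {Y : Submodule R (M ⧸ U) // pS p 1 ⊤ ≤ Y ∧ HT p Y β} := by
  refine Nat.card_congr (Equiv.ofBijective (fun X => ⟨X.1.map U.mkQ, ?_, X.2.2.2⟩) ⟨?_, ?_⟩)
  · rw [pS_quot_top]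
    exact Submodule.map_mono X.2.2.1
  · rintro ⟨X, h1, h2, h3⟩ ⟨X', h1', h2', h3'⟩ h
    have h := congrArg Subtype.val h
    simp only at h
    have h4 := congrArg (Submodule.comap U.mkQ) h
    rw [Submodule.comap_map_mkQ, Submodule.comap_map_mkQ, sup_eq_right.2 h1, sup_eq_right.2 h1'] at h4
    exact Subtype.ext h4
  · rintro ⟨Y, h1, h2⟩
    have e : (Y.comap U.mkQ).map U.mkQ = Y :=
      Submodule.map_comap_eq_of_surjective (Submodule.mkQ_surjective U) Y
    refine ⟨⟨Y.comap U.mkQ, Submodule.le_comap_mkQ U Y, ?_, ?_⟩, Subtype.ext e⟩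
    · rw [← Submodule.map_le_iff_le_comap, ← pS_quot_top]; exact h1
    · rw [e]; exact h2

lemma count_swap [Finite M] {α β : ℕ →₀ ℕ} [Fintype {X : Submodule R M // pS p 1 ⊤ ≤ X}]
    [Fintype {U : Submodule R M // HT p U α}] :
    ∑ X : {X : Submodule R M // pS p 1 ⊤ ≤ X},
      Nat.card {U : Submodule R M // U ≤ X.1 ∧ HT p U α ∧ HT p (X.1.map U.mkQ) β} =
    ∑ U : {U : Submodule R M // HT p U α},
      Nat.card {X : Submodule R M // U.1 ≤ X ∧ pS p 1 ⊤ ≤ X ∧ HT p (X.map U.1.mkQ) β} := by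
  rw [← Nat.card_sigma, ← Nat.card_sigma]
  exact Nat.card_congr
    ⟨fun z => ⟨⟨z.2.1, z.2.2.2.1⟩, ⟨z.1.1, z.2.2.1, z.1.2, z.2.2.2.2⟩⟩,
     fun z => ⟨⟨z.2.1, z.2.2.2.1⟩, ⟨z.1.1, z.2.2.1, z.1.2, z.2.2.2.2⟩⟩, fun _ => rfl, fun _ => rfl⟩

/-- shift of a sequence -/
noncomputable def shift (b : ℕ →₀ ℕ) : ℕ →₀ ℕ :=
  b.comapDomain Nat.succ (Nat.succ_injective.injOn)

lemma shift_apply (b : ℕ →₀ ℕ) (i : ℕ) : shift b i = b (i + 1) := rfl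

lemma HT_antitone (hq : 1 < qq p) [Finite M] {g : ℕ →₀ ℕ} (hM : HT p M g) : Antitone g := by
  intro i j h
  apply (Nat.pow_le_pow_iff_right hq).1
  rw [← hM i, ← hM j]
  exact card_le_of_le (pS_antitone h)

lemma shift_lt {b : ℕ →₀ ℕ} (h : Antitone b) (h0 : b ≠ 0) : shift b < b := by
  refine lt_of_le_of_ne (fun i => h (Nat.le_succ i)) ?_
  intro he
  apply h0
  have h1 : ∀ i, b i = b 0 := by
    intro i
    induction i with
    | zero => rfl
    | succ i ih => rw [← ih, ← shift_apply, he]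
  obtain ⟨n, hn⟩ := b.support.exists_nat_subset_range
  have h2 : b n = 0 := by
    by_contra h
    have := hn (Finsupp.mem_support_iff.2 h)
    simp at this
  ext i
  rw [h1 i, ← h1 n, h2]; rfl

lemma elem_top (hq : 1 < qq p) [Finite M] {b κ : ℕ →₀ ℕ} (hM : HT p M κ) (h0 : κ 0 = b 0)
    {Y : Submodule R M} (hY : pS p 1 ⊤ ≤ Y) (hYb : HT p Y (shift b)) : κ ≤ b := by
  intro i
  cases i with
  | zero => exact h0.le
  | succ i =>
    rw [HT_sub] at hYb
    apply (Nat.pow_le_pow_iff_right hq).1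
    rw [← shift_apply b, ← hYb i, ← hM (i + 1), ← pS_add]
    exact card_le_of_le (pS_mono hY)

lemma elem_one [Finite M] {b : ℕ →₀ ℕ} (hM : HT p M b) :
    Nat.card {Y : Submodule R M // pS p 1 ⊤ ≤ Y ∧ HT p Y (shift b)} = 1 := by
  rw [Nat.card_eq_one_iff_unique]
  have h : ∀ Y : Submodule R M, pS p 1 ⊤ ≤ Y ∧ HT p Y (shift b) → pS p 1 ⊤ = Y := by
    rintro Y ⟨h1, h2⟩
    apply eq_of_le_card h1
    rw [HT_sub] at h2
    have := h2 0
    rw [pS_zero] at this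
    rw [this, hM 1, shift_apply]
  refine ⟨⟨fun x y => Subtype.ext ((h _ x.2).symm.trans (h _ y.2))⟩, ⟨⟨pS p 1 ⊤, le_rfl, ?_⟩⟩⟩
  rw [HT_sub]
  intro i
  rw [pS_add, hM (i + 1), shift_apply]

theorem hall_poly (β : ℕ →₀ ℕ) : ∀ α l : ℕ →₀ ℕ, ∃ P : Polynomial ℤ,
    ∀ (R : Type) [CommRing R] (p : R)
    (_ : (Ideal.span {p}).IsMaximal) [Finite (R ⧸ Ideal.span {p})] (M : Type) [AddCommGroup M]
    [Module R M] [Finite M], HT p M l →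
    (Nat.card {U : Submodule R M // HT p U α ∧ HT p (M ⧸ U) β} : ℤ) = P.eval (qq p : ℤ) := by
  classical
  induction β using WellFoundedLT.induction with
  | ind β ih =>
  intro α l
  by_cases hanti : Antitone β
  swap
  · refine ⟨0, ?_⟩
    intro R _ p hp _ M _ _ _ hM
    have hq := one_lt_qq hp
    simp only [eval_zero, Nat.cast_eq_zero, Nat.card_eq_zero]
    left
    refine ⟨?_⟩
    rintro ⟨X, h1, h2⟩
    have hfin : Finite (M ⧸ X) := Finite.of_surjective _ (Submodule.mkQ_surjective X)
    exact hanti (HT_antitone hq h2)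
  by_cases h0 : l 0 = α 0 + β 0
  swap
  · refine ⟨0, ?_⟩
    intro R _ p hp _ M _ _ _ hM
    have hq := one_lt_qq hp
    simp only [eval_zero, Nat.cast_eq_zero, Nat.card_eq_zero]
    left
    refine ⟨?_⟩
    rintro ⟨X, h1, h2⟩
    exact h0 (HT_add_zero hq hM h1 h2)
  by_cases hβ : β = 0
  · refine ⟨if α = l then 1 else 0, ?_⟩
    intro R _ p hp _ M _ _ _ hM
    have hq := one_lt_qq hp
    have htop : ∀ U : Submodule R M, HT p (M ⧸ U) β ↔ U = ⊤ := by
      intro U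
      have hfin : Finite (M ⧸ U) := Finite.of_surjective _ (Submodule.mkQ_surjective U)
      constructor
      · intro h
        have h1 := h 0
        rw [pS_zero, hβ, Finsupp.coe_zero, Pi.zero_apply, pow_zero,
          Nat.card_congr Submodule.topEquiv.toEquiv] at h1
        exact Submodule.Quotient.subsingleton_iff.1 (Finite.card_le_one_iff_subsingleton.1 h1.le)
      · intro h
        have hs := Submodule.Quotient.subsingleton_iff.2 h
        intro i
        rw [hβ, Finsupp.coe_zero, Pi.zero_apply, pow_zero]
        exact Nat.card_of_subsingleton 0
    have htl : HT p (⊤ : Submodule R M) l := HT_congr Submodule.topEquiv.symm hM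
    split_ifs with h
    · simp only [eval_one, Nat.cast_eq_one]
      rw [Nat.card_eq_one_iff_unique]
      refine ⟨⟨fun x y => Subtype.ext (((htop _).1 x.2.2).trans ((htop _).1 y.2.2).symm)⟩,
        ⟨⟨⊤, ?_, (htop _).2 rfl⟩⟩⟩
      rw [h]; exact htl
    · simp only [eval_zero, Nat.cast_eq_zero, Nat.card_eq_zero]
      left
      refine ⟨?_⟩
      rintro ⟨X, h1, h2⟩
      rw [htop] at h2
      subst h2
      exact h (HT_unique hq h1 htl)
  have hlt := shift_lt hanti hβ
  choose PH hPH using ih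
  choose PE hPE using elem_poly
  refine ⟨(∑ μ ∈ Finset.Iic l, PE l μ * PH (shift β) hlt α μ) -
    ∑ κ ∈ (Finset.Iio β).attach, PH κ.1 (Finset.mem_Iio.1 κ.2) α l * PE κ.1 (shift β), ?_⟩
  intro R _ p hp _ M _ _ _ hM
  have hq := one_lt_qq hp
  have hfin : ∀ U : Submodule R M, Finite (M ⧸ U) :=
    fun U => Finite.of_surjective _ (Submodule.mkQ_surjective U)
  let _ : Fintype {X : Submodule R M // pS p 1 ⊤ ≤ X} := Fintype.ofFinite _
  let _ : Fintype {U : Submodule R M // HT p U α} := Fintype.ofFinite _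
  have hsw := count_swap (p := p) (M := M) (α := α) (β := shift β)
  have hsw : ((∑ X : {X : Submodule R M // pS p 1 ⊤ ≤ X},
      Nat.card {U : Submodule R M // U ≤ X.1 ∧ HT p U α ∧ HT p (X.1.map U.mkQ) (shift β)} : ℕ) : ℤ) =
    ((∑ U : {U : Submodule R M // HT p U α},
      Nat.card {X : Submodule R M // U.1 ≤ X ∧ pS p 1 ⊤ ≤ X ∧ HT p (X.map U.1.mkQ) (shift β)} : ℕ) : ℤ) := by
    rw [hsw]
  push_cast at hsw
  -- left side
  have hL : ∑ X : {X : Submodule R M // pS p 1 ⊤ ≤ X},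
      (Nat.card {U : Submodule R M // U ≤ X.1 ∧ HT p U α ∧ HT p (X.1.map U.mkQ) (shift β)} : ℤ) =
      ∑ μ ∈ Finset.Iic l, (PE l μ).eval (qq p : ℤ) * (PH (shift β) hlt α μ).eval (qq p : ℤ) := by
    have h1 : ∀ X : {X : Submodule R M // pS p 1 ⊤ ≤ X},
      (Nat.card {U : Submodule R M // U ≤ X.1 ∧ HT p U α ∧ HT p (X.1.map U.mkQ) (shift β)} : ℤ) =
      (fun μ => (PH (shift β) hlt α μ).eval (qq p : ℤ)) (ty p X.1) := by
      intro X
      rw [count_left, hPH (shift β) hlt α (ty p X.1) R p hp X.1 (HT_ty_sub hp hM X.1)]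
    rw [Finset.sum_congr rfl (fun X _ => h1 X), sum_by_type (fun X : {X : Submodule R M // pS p 1 ⊤ ≤ X} => ty p X.1)
      (Finset.Iic l) (fun μ => (PH (shift β) hlt α μ).eval (qq p : ℤ))]
    · apply Finset.sum_congr rfl
      intro μ _
      congr 1
      rw [← hPE l μ R p hp M hM]
      congr 1
      refine Nat.card_congr ⟨fun z => ⟨z.1.1, z.1.2, ?_⟩, fun z => ⟨⟨z.1, z.2.1⟩, ty_eq hq z.2.2⟩,
        fun _ => rfl, fun _ => rfl⟩
      have := HT_ty_sub hp hM z.1.1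
      rwa [z.2] at this
    · intro X hX
      exact absurd (Finset.mem_Iic.2 (HT_sub_le hq hM (HT_ty_sub hp hM X.1))) hX
  -- right side
  have hR : ∑ U : {U : Submodule R M // HT p U α},
      (Nat.card {X : Submodule R M // U.1 ≤ X ∧ pS p 1 ⊤ ≤ X ∧ HT p (X.map U.1.mkQ) (shift β)} : ℤ) =
      (∑ κ ∈ (Finset.Iio β).attach, (PH κ.1 (Finset.mem_Iio.1 κ.2) α l).eval (qq p : ℤ) *
        (PE κ.1 (shift β)).eval (qq p : ℤ)) +
      (Nat.card {U : Submodule R M // HT p U α ∧ HT p (M ⧸ U) β} : ℤ) := by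
    let G : (ℕ →₀ ℕ) → ℤ := fun κ => if κ ≤ β then
      (if κ = β then 1 else (PE κ (shift β)).eval (qq p : ℤ)) else 0
    have h1 : ∀ U : {U : Submodule R M // HT p U α},
      (Nat.card {X : Submodule R M // U.1 ≤ X ∧ pS p 1 ⊤ ≤ X ∧ HT p (X.map U.1.mkQ) (shift β)} : ℤ) =
      G (ty p (M ⧸ U.1)) := by
      rintro ⟨U, hU⟩
      have ht := HT_ty_quot hp hM U
      simp only [G]
      rw [count_right]
      split_ifs with c1 c2
      · rw [c2] at ht
        rw [elem_one ht]; rfl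
      · exact hPE _ _ R p hp _ ht
      · simp only [Nat.cast_eq_zero, Nat.card_eq_zero]
        left
        refine ⟨?_⟩
        rintro ⟨Y, h1, h2⟩
        apply c1
        have h3 := HT_add_zero hq hM hU ht
        exact elem_top hq ht (by omega) h1 h2
    have h2 : ∀ κ, Nat.card {i : {U : Submodule R M // HT p U α} // ty p (M ⧸ i.1) = κ} =
        Nat.card {U : Submodule R M // HT p U α ∧ HT p (M ⧸ U) κ} := by
      intro κ
      refine Nat.card_congr ⟨fun z => ⟨z.1.1, z.1.2, ?_⟩, fun z => ⟨⟨z.1, z.2.1⟩, ty_eq hq z.2.2⟩,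
        fun _ => rfl, fun _ => rfl⟩
      have := HT_ty_quot hp hM z.1.1
      rwa [z.2] at this
    rw [Finset.sum_congr rfl (fun U _ => h1 U),
      sum_by_type (fun U : {U : Submodule R M // HT p U α} => ty p (M ⧸ U.1)) (Finset.Iic β)]
    · rw [← Finset.Iio_insert β, Finset.sum_insert (by simp), add_comm]
      congr 1
      · rw [← Finset.sum_attach]
        apply Finset.sum_congr rfl
        rintro ⟨κ, hκ⟩ _
        have hκ' := Finset.mem_Iio.1 hκ
        rw [h2, hPH κ hκ' α l R p hp M hM]
        simp only [G, if_pos hκ'.le, if_neg hκ'.ne]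
      · rw [h2]; simp [G]
    · intro U hU
      rw [Finset.mem_Iic] at hU
      simp only [G, if_neg hU]
  rw [hL, hR] at hsw
  rw [eval_sub, eval_finset_sum, eval_finset_sum]
  simp only [eval_mul]
  rw [hsw]; ring

end core
end SegreHall

namespace SegreHall

/-- number of parts bigger than `i` -/
noncomputable def cnt (l : Multiset ℕ+) (i : ℕ) : ℕ := Multiset.countP (fun c : ℕ+ => i < (c : ℕ)) l

lemma cnt_add (a b : Multiset ℕ+) (i : ℕ) : cnt (a + b) i = cnt a i + cnt b i :=
  Multiset.countP_add _ _ _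

lemma cnt_zero (i : ℕ) : cnt 0 i = 0 := rfl

lemma cnt_sum {ι : Type*} (s : Finset ι) (f : ι → Multiset ℕ+) (i : ℕ) :
    cnt (∑ j ∈ s, f j) i = ∑ j ∈ s, cnt (f j) i :=
  map_sum (Multiset.countPAddMonoidHom (fun c : ℕ+ => i < (c : ℕ))) f s

lemma cnt_cons (a : ℕ+) (l : Multiset ℕ+) (i : ℕ) :
    cnt (a ::ₘ l) i = cnt l i + if i < (a : ℕ) then 1 else 0 := by
  rw [cnt, Multiset.countP_cons]; rfl

lemma cnt_single (a : ℕ+) (i : ℕ) : cnt {a} i = if i < (a : ℕ) then 1 else 0 := by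
  rw [← Multiset.cons_zero, cnt_cons, cnt_zero, zero_add]

lemma count_cnt (l : Multiset ℕ+) (c : ℕ+) : cnt l (c - 1) = l.count c + cnt l c := by
  induction l using Multiset.induction_on with
  | empty => rfl
  | cons a l ih =>
    rw [cnt_cons, cnt_cons, ih, Multiset.count_cons]
    have h := c.pos
    by_cases h1 : c = a
    · subst h1
      rw [if_pos (by omega), if_pos rfl, if_neg (by omega)]; omega
    · have h2 : (c : ℕ) ≠ a := fun h => h1 (PNat.coe_injective h)
      rw [if_neg h1]
      split_ifs <;> omega

lemma cnt_inj {a b : Multiset ℕ+} (h : ∀ i, cnt a i = cnt b i) : a = b := by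
  ext c
  have h1 := count_cnt a c
  have h2 := count_cnt b c
  rw [h, h] at h1
  omega

/-- the function `i ↦ Σ_{c ∈ l} (c - i)` -/
noncomputable def gOfFun (l : Multiset ℕ+) (i : ℕ) : ℕ := (Multiset.map (fun c : ℕ+ => (c : ℕ) - i) l).sum

lemma gOfFun_cons (a : ℕ+) (l : Multiset ℕ+) (i : ℕ) :
    gOfFun (a ::ₘ l) i = ((a : ℕ) - i) + gOfFun l i := by
  simp [gOfFun]

lemma gOfFun_succ (l : Multiset ℕ+) (i : ℕ) : gOfFun l i = gOfFun l (i + 1) + cnt l i := by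
  induction l using Multiset.induction_on with
  | empty => rfl
  | cons a l ih =>
    rw [gOfFun_cons, gOfFun_cons, cnt_cons, ih]
    split_ifs <;> omega

lemma gOfFun_bdd (l : Multiset ℕ+) : ∃ n, ∀ i, n ≤ i → gOfFun l i = 0 := by
  induction l using Multiset.induction_on with
  | empty => exact ⟨0, fun _ _ => rfl⟩
  | cons a l ih =>
    obtain ⟨n, hn⟩ := ih
    refine ⟨max n a, fun i hi => ?_⟩
    rw [gOfFun_cons, hn i (le_trans (le_max_left _ _) hi)]
    have := le_trans (le_max_right n a) hi
    omega

/-- finitely supported version -/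
noncomputable def gOf (l : Multiset ℕ+) : ℕ →₀ ℕ :=
  Finsupp.onFinset (Finset.range (gOfFun_bdd l).choose) (gOfFun l) (by
    intro i hi
    rw [Finset.mem_range]
    by_contra hc
    exact hi ((gOfFun_bdd l).choose_spec i (by omega)))

lemma gOf_succ (l : Multiset ℕ+) (i : ℕ) : gOf l i = gOf l (i + 1) + cnt l i :=
  gOfFun_succ l i

lemma gOf_bdd (l : Multiset ℕ+) : ∃ n, ∀ i, n ≤ i → gOf l i = 0 := gOfFun_bdd l

lemma gOf_inj : Function.Injective gOf := by
  intro a b h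
  apply cnt_inj
  intro i
  have h1 := gOf_succ a i
  have h2 := gOf_succ b i
  rw [h] at h1
  omega

section types
variable {R : Type} [CommRing R] {p : R}
variable {M : Type} [AddCommGroup M] [Module R M]
variable {N : Type} [AddCommGroup N] [Module R N]

/-- `l` is the type of `M` at `p` -/
def HasType (p : R) (M : Type) [AddCommGroup M] [Module R M] (l : Multiset ℕ+) : Prop :=
  ∀ i, Nat.card (pS p i (⊤ : Submodule R M)) =
    Nat.card (pS p (i + 1) (⊤ : Submodule R M)) * qq p ^ cnt l i

lemma HasType.congr (e : M ≃ₗ[R] N) {l : Multiset ℕ+} (h : HasType p M l) : HasType p N l := by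
  have h1 : ∀ i, Nat.card (pS p i (⊤ : Submodule R N)) = Nat.card (pS p i (⊤ : Submodule R M)) := by
    intro i
    rw [← card_map_inj e.toLinearMap e.injective, ← pS_map, Submodule.map_top, LinearEquiv.range]
  intro i
  rw [h1, h1, h i]

lemma HasType.unique (hq : 1 < qq p) [Finite M] {a b : Multiset ℕ+} (ha : HasType p M a)
    (hb : HasType p M b) : a = b := by
  apply cnt_inj
  intro i
  apply Nat.pow_right_injective hq
  have h := (ha i).symm.trans (hb i)
  exact Nat.eq_of_mul_eq_mul_left Nat.card_pos h

lemma pS_pi {ι : Type} (M : ι → Type) [∀ i, AddCommGroup (M i)]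
    [∀ i, Module R (M i)] (j : ℕ) :
    pS p j (⊤ : Submodule R (∀ i, M i)) = Submodule.pi Set.univ (fun _ => pS p j ⊤) := by
  ext x
  simp only [mem_pS, Submodule.mem_pi, Submodule.mem_top, true_and, Set.mem_univ, true_implies]
  constructor
  · rintro ⟨u, rfl⟩ i
    exact ⟨u i, rfl⟩
  · intro h
    choose u hu using h
    exact ⟨u, funext hu⟩

lemma card_submodule_pi {ι : Type} [Fintype ι] (M : ι → Type) [∀ i, AddCommGroup (M i)]
    [∀ i, Module R (M i)] (U : ∀ i, Submodule R (M i)) :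
    Nat.card (Submodule.pi Set.univ U) = ∏ i, Nat.card (U i) := by
  rw [← Nat.card_pi]
  refine Nat.card_congr ⟨fun x i => ⟨x.1 i, x.2 i trivial⟩, fun x => ⟨fun i => (x i).1, fun i _ => (x i).2⟩,
    fun _ => rfl, fun _ => rfl⟩

lemma HasType.pi {ι : Type} [Fintype ι] (M : ι → Type) [∀ i, AddCommGroup (M i)]
    [∀ i, Module R (M i)] (l : ι → Multiset ℕ+) (h : ∀ i, HasType p (M i) (l i)) :
    HasType p (∀ i, M i) (∑ i, l i) := by
  intro j
  rw [pS_pi, pS_pi, card_submodule_pi, card_submodule_pi, cnt_sum, ← Finset.prod_pow_eq_pow_sum,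
    ← Finset.prod_mul_distrib]
  exact Finset.prod_congr rfl (fun i _ => h i j)

lemma HasType.of_HT {l : Multiset ℕ+} (h : HT p M (gOf l)) : HasType p M l := by
  intro i
  rw [h i, h (i + 1), ← pow_add, ← gOf_succ]

lemma HasType.toHT [Finite M] {l : Multiset ℕ+} (h : HasType p M l) {n : ℕ}
    (hn : ∀ x : M, p ^ n • x = 0) : HT p M (gOf l) := by
  obtain ⟨m, hm⟩ := gOf_bdd l
  have h1 : ∀ i, n ≤ i → Nat.card (pS p i (⊤ : Submodule R M)) = 1 := by
    intro i hi
    have : pS p i (⊤ : Submodule R M) = ⊥ := by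
      rw [eq_bot_iff]
      intro x hx
      obtain ⟨u, _, rfl⟩ := mem_pS.1 hx
      obtain ⟨c, rfl⟩ := Nat.exists_eq_add_of_le hi
      rw [add_comm, pow_add, mul_smul, hn]; simp
    rw [this]; simp
  have key : ∀ j i, max n m ≤ i + j → Nat.card (pS p i (⊤ : Submodule R M)) = qq p ^ (gOf l i) := by
    intro j
    induction j with
    | zero =>
      intro i hi
      have := le_max_left n m
      have := le_max_right n m
      rw [h1 i (by omega), hm i (by omega), pow_zero]
    | succ j ih =>
      intro i hi
      rw [h i, ih (i + 1) (by omega), gOf_succ l i, pow_add]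
  intro i
  exact key (max n m) i (by omega)

lemma pS_top_of_surj (h : pS p 1 (⊤ : Submodule R M) = ⊤) (i : ℕ) :
    pS p i (⊤ : Submodule R M) = ⊤ := by
  induction i with
  | zero => exact pS_zero
  | succ i ih => rw [← pS_add, h, ih]

lemma HasType.zero_of (h : pS p 1 (⊤ : Submodule R M) = ⊤) : HasType p M 0 := by
  intro i
  rw [pS_top_of_surj h, pS_top_of_surj h, cnt_zero, pow_zero, mul_one]

lemma HasType.surj [Finite M] (h : HasType p M 0) : Function.Surjective (fun x : M => p • x) := by
  have h1 := h 0
  rw [pS_zero, cnt_zero, pow_zero, mul_one] at h1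
  have h2 := eq_of_le_card (pS_le (p := p) (i := 0 + 1) (U := (⊤ : Submodule R M))) h1.le
  intro x
  have hx : x ∈ pS p (0 + 1) (⊤ : Submodule R M) := by rw [h2]; trivial
  obtain ⟨u, _, hu⟩ := mem_pS.1 hx
  exact ⟨u, by simpa using hu⟩

lemma pS_one_of_surj (h : Function.Surjective (fun x : M => p • x)) :
    pS p 1 (⊤ : Submodule R M) = ⊤ := by
  rw [eq_top_iff]
  intro x _
  obtain ⟨y, hy⟩ := h x
  exact mem_pS.2 ⟨y, trivial, by simpa using hy⟩

lemma HasType.zero_sub [Finite M] (h : HasType p M 0) (U : Submodule R M) : HasType p U 0 := by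
  apply HasType.zero_of
  apply pS_one_of_surj
  have hinj : Function.Injective (fun x : M => p • x) := Finite.injective_iff_surjective.2 h.surj
  apply Finite.injective_iff_surjective.1
  intro x y hxy
  apply Subtype.ext
  apply hinj
  exact congrArg Subtype.val hxy

lemma HasType.zero_quot [Finite M] (h : HasType p M 0) (U : Submodule R M) :
    HasType p (M ⧸ U) 0 := by
  apply HasType.zero_of
  apply pS_one_of_surj
  intro x
  obtain ⟨x, rfl⟩ := Submodule.mkQ_surjective _ x
  obtain ⟨y, hy⟩ := h.surj x
  exact ⟨U.mkQ y, by rw [← hy]; simp⟩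

lemma HasType.quot_pow [IsDomain R] (hp : (Ideal.span {p}).IsMaximal) (hp0 : p ≠ 0) (e : ℕ+) :
    HasType p (R ⧸ Ideal.span {p ^ (e : ℕ)}) {e} := by
  have hmem : ∀ (i : ℕ) (r : R), (Ideal.Quotient.mk (Ideal.span {p ^ (e : ℕ)}) r) ∈
      pS p i (⊤ : Submodule R (R ⧸ Ideal.span {p ^ (e : ℕ)})) ↔ ∃ a b, r = p ^ i * a + p ^ (e : ℕ) * b := by
    intro i r
    rw [mem_pS]
    constructor
    · rintro ⟨u, _, hu⟩
      obtain ⟨u, rfl⟩ := Ideal.Quotient.mk_surjective u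
      have h1 : Ideal.Quotient.mk (Ideal.span {p ^ (e : ℕ)}) (p ^ i * u) =
        Ideal.Quotient.mk (Ideal.span {p ^ (e : ℕ)}) r := hu
      rw [Ideal.Quotient.eq, Ideal.mem_span_singleton] at h1
      obtain ⟨c, hc⟩ := h1
      exact ⟨u, -c, by linear_combination -hc⟩
    · rintro ⟨a, b, rfl⟩
      refine ⟨Ideal.Quotient.mk _ a, trivial, ?_⟩
      change Ideal.Quotient.mk (Ideal.span {p ^ (e : ℕ)}) (p ^ i * a) = _
      rw [Ideal.Quotient.eq, Ideal.mem_span_singleton]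
      exact ⟨-b, by ring⟩
  have hnu : ¬ IsUnit p := fun h => hp.ne_top (Ideal.span_singleton_eq_top.2 h)
  intro i
  rw [cnt_single]
  split_ifs with hi
  · rw [pow_one, ← card_sup_span hp (A := pS p (i + 1) ⊤)
      (x := Ideal.Quotient.mk (Ideal.span {p ^ (e : ℕ)}) (p ^ i))]
    · have hEq : pS p i (⊤ : Submodule R (R ⧸ Ideal.span {p ^ (e : ℕ)})) = pS p (i + 1) ⊤ ⊔
          Submodule.span R {Ideal.Quotient.mk (Ideal.span {p ^ (e : ℕ)}) (p ^ i)} := ?_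
      · rw [← hEq]
      apply le_antisymm
      · intro x hx
        obtain ⟨x, rfl⟩ := Ideal.Quotient.mk_surjective x
        obtain ⟨u, _, hu⟩ := mem_pS.1 hx
        rw [← hu]
        obtain ⟨u, rfl⟩ := Ideal.Quotient.mk_surjective u
        apply Submodule.mem_sup_right
        rw [Submodule.mem_span_singleton]
        exact ⟨u, by
          change Ideal.Quotient.mk (Ideal.span {p ^ (e : ℕ)}) (u * p ^ i) =
            Ideal.Quotient.mk (Ideal.span {p ^ (e : ℕ)}) (p ^ i * u)
          rw [mul_comm]⟩
      · apply sup_le (pS_antitone (Nat.le_succ i))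
        rw [Submodule.span_singleton_le_iff_mem, hmem]
        exact ⟨1, 0, by ring⟩
    · rw [hmem]
      rintro ⟨a, b, h⟩
      obtain ⟨c, hc⟩ := Nat.exists_eq_add_of_lt hi
      rw [hc] at h
      have h2 : p ^ i * (1 - p * (a + p ^ c * b)) = 0 := by
        rw [mul_sub, mul_one]
        nth_rewrite 1 [h]
        ring
      rcases mul_eq_zero.1 h2 with h3 | h3
      · exact pow_ne_zero i hp0 h3
      · exact hnu (IsUnit.of_mul_eq_one _ (sub_eq_zero.1 h3).symm)
    · change Ideal.Quotient.mk (Ideal.span {p ^ (e : ℕ)}) (p * p ^ i) ∈ _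
      rw [hmem]
      exact ⟨1, 0, by ring⟩
  · have hb : ∀ j, (e : ℕ) ≤ j → pS p j (⊤ : Submodule R (R ⧸ Ideal.span {p ^ (e : ℕ)})) = ⊥ := by
      intro j hj
      rw [eq_bot_iff]
      intro x hx
      obtain ⟨u, _, rfl⟩ := mem_pS.1 hx
      obtain ⟨u, rfl⟩ := Ideal.Quotient.mk_surjective u
      rw [Submodule.mem_bot]
      change Ideal.Quotient.mk (Ideal.span {p ^ (e : ℕ)}) (p ^ j * u) = 0
      rw [Ideal.Quotient.eq_zero_iff_mem, Ideal.mem_span_singleton]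
      exact (pow_dvd_pow p hj).mul_right u
    rw [hb i (by omega), hb (i + 1) (by omega), pow_zero, mul_one]

lemma HasType.quot_coprime {s : R} (h : IsCoprime p s) : HasType p (R ⧸ Ideal.span {s}) 0 := by
  apply HasType.zero_of
  apply pS_one_of_surj
  obtain ⟨a, b, hab⟩ := h
  intro x
  obtain ⟨x, rfl⟩ := Ideal.Quotient.mk_surjective x
  refine ⟨Ideal.Quotient.mk _ (a * x), ?_⟩
  change Ideal.Quotient.mk (Ideal.span {s}) (p * (a * x)) = _
  rw [Ideal.Quotient.eq, Ideal.mem_span_singleton]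
  exact ⟨-b * x, by linear_combination x * hab⟩

end types
end SegreHall

namespace SegreHall

section kt
variable {k : Type} [Field k]

/-- monic irreducible -/
def MI (p : k[X]) : Prop := p.Monic ∧ Irreducible p

lemma MI.max {p : k[X]} (h : MI p) : (Ideal.span {p}).IsMaximal :=
  PrincipalIdealRing.isMaximal_of_irreducible h.2

lemma finite_quot [Finite k] {p : k[X]} (h : p ≠ 0) : Finite (k[X] ⧸ Ideal.span {p}) := by
  have : Module.Finite k (k[X] ⧸ Ideal.span {p}) := by
    have := (AdjoinRoot.powerBasis h).finite
    exact this
  exact Module.finite_of_finite k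

lemma MI.fin [Finite k] {p : k[X]} (h : MI p) : Finite (k[X] ⧸ Ideal.span {p}) :=
  finite_quot h.2.ne_zero

lemma MI.qq [Fintype k] {p : k[X]} (h : MI p) : qq p = Fintype.card k ^ p.natDegree := by
  have := h.fin
  have := Fintype.ofFinite (k[X] ⧸ Ideal.span {p})
  rw [SegreHall.qq, Nat.card_eq_fintype_card, Module.card_eq_pow_finrank (K := k),
    finrank_quotient_span_eq_natDegree]

lemma MI.one_lt [Finite k] {p : k[X]} (h : MI p) : 1 < SegreHall.qq p := by
  have := h.fin
  exact one_lt_qq h.max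

lemma MI.coprime {p q : k[X]} (hp : MI p) (hq : MI q) (h : p ≠ q) : IsCoprime p q := by
  rw [Irreducible.coprime_iff_not_dvd hp.2]
  intro hd
  exact h (eq_of_monic_of_associated hp.1 hq.1 (hp.2.associated_of_dvd hq.2 hd))

open Classical in
lemma type_quot {p q : k[X]} (hp : MI p) (hq : MI q) (e : ℕ+) :
    HasType p (k[X] ⧸ Ideal.span {q ^ (e : ℕ)}) (if q = p then {e} else 0) := by
  split_ifs with h
  · subst h
    exact HasType.quot_pow hp.max hp.2.ne_zero e
  · exact HasType.quot_coprime ((hp.coprime hq (Ne.symm h)).pow_right)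

/-- a decomposition of a module into primary cyclic modules -/
structure Flat (M : Type) [AddCommGroup M] [Module k[X] M] where
  ι : Type
  fin : Fintype ι
  p : ι → k[X]
  e : ι → ℕ+
  mi : ∀ i, MI (p i)
  eqv : M ≃ₗ[k[X]] (∀ i, k[X] ⧸ Ideal.span {p i ^ (e i : ℕ)})

lemma exists_flat [Finite k] (M : Type) [AddCommGroup M] [Module k[X] M] [Finite M] :
    Nonempty (Flat (k := k) M) := by
  classical
  have htors : Module.IsTorsion k[X] M := by
    intro x
    by_contra hc
    have hinj : Function.Injective (fun r : k[X] => r • x) := by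
      intro r s hrs
      by_contra hne
      apply hc
      refine ⟨⟨r - s, mem_nonZeroDivisors_of_ne_zero (sub_ne_zero.2 hne)⟩, ?_⟩
      change (r - s) • x = 0
      rw [sub_smul]
      exact sub_eq_zero.2 hrs
    have : Finite k[X] := Finite.of_injective _ hinj
    exact not_finite k[X]
  obtain ⟨ι, hι, p, hp, e, ⟨E⟩⟩ := Module.equiv_directSum_of_isTorsion htors
  let E1 : M ≃ₗ[k[X]] (∀ i, k[X] ⧸ Ideal.span {p i ^ e i}) :=
    E.trans (DirectSum.linearEquivFunOnFintype k[X] ι _)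
  let J := {i : ι // e i ≠ 0}
  have hspan : ∀ i, Ideal.span {p i ^ e i} = Ideal.span {(normalize (p i)) ^ e i} := by
    intro i
    rw [Ideal.span_singleton_eq_span_singleton]
    exact (normalize_associated (p i)).symm.pow_pow
  let E2 : (∀ i, k[X] ⧸ Ideal.span {p i ^ e i}) ≃ₗ[k[X]]
      (∀ i : J, k[X] ⧸ Ideal.span {p i.1 ^ e i.1}) :=
    LinearEquiv.ofBijective (LinearMap.pi (fun i => LinearMap.proj i.1)) (by
      constructor
      · intro x y h
        funext i
        by_cases hi : e i = 0
        · have : Subsingleton (k[X] ⧸ Ideal.span {p i ^ e i}) := by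
            rw [Ideal.Quotient.subsingleton_iff, hi, pow_zero]
            exact Ideal.span_singleton_one
          exact Subsingleton.elim _ _
        · exact congrFun h ⟨i, hi⟩
      · intro y
        refine ⟨fun i => if h : e i ≠ 0 then y ⟨i, h⟩ else 0, ?_⟩
        funext i
        change (if h : e i.1 ≠ 0 then y ⟨i.1, h⟩ else 0) = y i
        rw [dif_pos i.2])
  exact ⟨⟨J, inferInstance, fun i => normalize (p i.1), fun i => ⟨e i.1, Nat.pos_of_ne_zero i.2⟩,
    fun i => ⟨monic_normalize (hp i.1).ne_zero, (normalize_associated (p i.1)).symm.irreducible (hp i.1)⟩,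
    E1.trans (E2.trans (LinearEquiv.piCongrRight (fun i => Submodule.quotEquivOfEq _ _ (hspan i.1))))⟩⟩

open Classical in
lemma Flat.type {M : Type} [AddCommGroup M] [Module k[X] M] (f : Flat (k := k) M) {p : k[X]}
    (hp : MI p) : HasType p M (∑ i ∈ (f.fin).elems, if f.p i = p then {f.e i} else 0) := by
  let _ := f.fin
  exact HasType.congr f.eqv.symm
    (HasType.pi _ (fun i => if f.p i = p then {f.e i} else 0) (fun i => type_quot hp (f.mi i) _))

lemma exists_type [Finite k] (M : Type) [AddCommGroup M] [Module k[X] M] [Finite M] {p : k[X]}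
    (hp : MI p) : ∃ l, HasType p M l := by
  obtain ⟨f⟩ := exists_flat (k := k) M
  exact ⟨_, f.type hp⟩

lemma reindex {ι ι' : Type} [Fintype ι] [Fintype ι'] {β : Type*} [DecidableEq β]
    (f : ι → β) (g : ι' → β)
    (h : ∀ b, Nat.card {i // f i = b} = Nat.card {i // g i = b}) :
    ∃ s : ι ≃ ι', ∀ i, g (s i) = f i := by
  have : ∀ b, Nonempty ({i // f i = b} ≃ {i // g i = b}) := fun b =>
    Finite.card_eq.1 (h b)
  refine ⟨Equiv.ofFiberEquiv (fun b => (this b).some), fun i => ?_⟩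
  exact Equiv.ofFiberEquiv_map _ _

lemma iso_of_types [Finite k] {M N : Type} [AddCommGroup M] [Module k[X] M] [Finite M]
    [AddCommGroup N] [Module k[X] N] [Finite N]
    (h : ∀ p : k[X], MI p → ∀ l, HasType p M l → HasType p N l) : Nonempty (M ≃ₗ[k[X]] N) := by
  classical
  obtain ⟨f⟩ := exists_flat (k := k) M
  obtain ⟨g⟩ := exists_flat (k := k) N
  let _ := f.fin
  let _ := g.fin
  have key : ∀ (M : Type) [AddCommGroup M] [Module k[X] M] (f : Flat (k := k) M) (p : k[X]) (c : ℕ+),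
      Nat.card {i // (f.p i, f.e i) = (p, c)} =
        (∑ i ∈ (f.fin).elems, if f.p i = p then ({f.e i} : Multiset ℕ+) else 0).count c := by
    intro M _ _ f p c
    let _ := f.fin
    rw [Multiset.count_sum', Nat.card_eq_fintype_card, Fintype.card_subtype, Finset.card_filter]
    apply Finset.sum_congr rfl
    intro i _
    by_cases h1 : f.p i = p
    · simp only [Prod.mk.injEq, h1, true_and, if_true, Multiset.count_singleton, eq_comm]
    · simp [h1]
  obtain ⟨s, hs⟩ := reindex (fun i => (f.p i, f.e i)) (fun i => (g.p i, g.e i)) (by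
    rintro ⟨p, c⟩
    by_cases hp : MI p
    · rw [key, key]
      congr 1
      exact (h p hp _ (f.type hp)).unique hp.one_lt (g.type hp)
    · rw [Nat.card_eq_zero.2 (Or.inl ⟨?_⟩), Nat.card_eq_zero.2 (Or.inl ⟨?_⟩)]
      · rintro ⟨i, hi⟩
        exact hp ((Prod.mk.inj hi).1 ▸ g.mi i)
      · rintro ⟨i, hi⟩
        exact hp ((Prod.mk.inj hi).1 ▸ f.mi i))
  have hsp : ∀ i, Ideal.span {f.p i ^ (f.e i : ℕ)} = Ideal.span {g.p (s i) ^ (g.e (s i) : ℕ)} := by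
    intro i
    rw [← (Prod.mk.inj (hs i)).1, ← (Prod.mk.inj (hs i)).2]
  exact ⟨f.eqv.trans ((LinearEquiv.piCongrRight (fun i => Submodule.quotEquivOfEq _ _ (hsp i))).trans
    ((LinearEquiv.piCongrLeft k[X] (fun i => k[X] ⧸ Ideal.span {g.p i ^ (g.e i : ℕ)}) s).trans g.eqv.symm))⟩

open Classical in
/-- the type of a module at `p` -/
noncomputable def typ (p : k[X]) (M : Type) [AddCommGroup M] [Module k[X] M] : Multiset ℕ+ :=
  if h : ∃ l, HasType p M l then h.choose else 0

lemma hasType_typ [Finite k] (M : Type) [AddCommGroup M] [Module k[X] M] [Finite M] {p : k[X]}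
    (hp : MI p) : HasType p M (typ p M) := by
  have h := exists_type M hp
  rw [typ, dif_pos h]
  exact h.choose_spec

lemma typ_eq [Finite k] {M : Type} [AddCommGroup M] [Module k[X] M] [Finite M] {p : k[X]}
    (hp : MI p) {l : Multiset ℕ+} (h : HasType p M l) : typ p M = l :=
  (hasType_typ M hp).unique hp.one_lt h

lemma typ_iff [Finite k] {M : Type} [AddCommGroup M] [Module k[X] M] [Finite M] {p : k[X]}
    (hp : MI p) {l : Multiset ℕ+} : HasType p M l ↔ typ p M = l :=
  ⟨typ_eq hp, fun h => h ▸ hasType_typ M hp⟩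

lemma typ_congr [Finite k] {M N : Type} [AddCommGroup M] [Module k[X] M] [Finite M]
    [AddCommGroup N] [Module k[X] N] [Finite N] (e : M ≃ₗ[k[X]] N) {p : k[X]} (hp : MI p) :
    typ p M = typ p N :=
  typ_eq hp (HasType.congr e.symm (hasType_typ N hp))

end kt
end SegreHall

namespace SegreHall

section kt
variable {k : Type} [Field k]

lemma HasType.zero_of_kill {R : Type} [CommRing R] {p s : R} {M : Type} [AddCommGroup M] [Module R M]
    (h : IsCoprime p s) (hs : ∀ x : M, s • x = 0) : HasType p M 0 := by
  apply HasType.zero_of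
  apply pS_one_of_surj
  obtain ⟨a, b, hab⟩ := h
  intro x
  refine ⟨a • x, ?_⟩
  have : (a * p + b * s) • x = x := by rw [hab, one_smul]
  rw [add_smul, mul_smul b, hs, smul_zero, add_zero] at this
  simp only
  rw [← mul_smul, mul_comm, this]

variable {ι : Type} [Fintype ι] {P : ι → k[X]} {M : ι → Type} [∀ i, AddCommGroup (M i)]
  [∀ i, Module k[X] (M i)]

lemma sub_pi [DecidableEq ι] (hP : ∀ i, MI (P i)) (hinj : Function.Injective P) {n : ℕ}
    (hn : ∀ i (x : M i), P i ^ n • x = 0) (U : Submodule k[X] (∀ i, M i)) :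
    Submodule.pi Set.univ (fun i => U.map (LinearMap.proj i)) = U := by
  have hidem : ∀ i, ∃ e : k[X], ∀ x : (∀ i, M i), e • x = Pi.single i (x i) := by
    intro i
    have hc : IsCoprime (P i ^ n) (∏ j ∈ Finset.univ.erase i, P j ^ n) := by
      apply IsCoprime.prod_right
      intro j hj
      apply IsCoprime.pow
      exact (hP i).coprime (hP j) (fun h => (Finset.ne_of_mem_erase hj) (hinj h).symm)
    obtain ⟨a, b, hab⟩ := hc
    refine ⟨b * ∏ j ∈ Finset.univ.erase i, P j ^ n, fun x => ?_⟩
    funext j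
    rw [Pi.smul_apply]
    by_cases hj : j = i
    · subst hj
      rw [Pi.single_eq_same]
      have : b * ∏ i ∈ Finset.univ.erase j, P i ^ n = 1 - a * P j ^ n := by
        rw [← hab]; ring
      rw [this, sub_smul, one_smul, mul_smul, hn, smul_zero, sub_zero]
    · rw [Pi.single_eq_of_ne hj]
      have hd : P j ^ n ∣ b * ∏ i ∈ Finset.univ.erase i, P i ^ n :=
        (Finset.dvd_prod_of_mem (fun i => P i ^ n) (Finset.mem_erase.2 ⟨hj, Finset.mem_univ j⟩)).mul_left b
      obtain ⟨c, hc⟩ := hd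
      rw [hc, mul_comm, mul_smul, hn, smul_zero]
  choose e he using hidem
  apply le_antisymm
  · intro x hx
    rw [Submodule.mem_pi] at hx
    have hx2 : ∀ i, Pi.single i (x i) ∈ U := by
      intro i
      obtain ⟨y, hy, hyx⟩ := hx i trivial
      have h1 : e i • y ∈ U := U.smul_mem _ hy
      rw [he i y] at h1
      have h2 : y i = x i := hyx
      rwa [h2] at h1
    rw [← Finset.univ_sum_single x]
    exact U.sum_mem (fun i _ => hx2 i)
  · intro x hx
    rw [Submodule.mem_pi]
    intro i _
    exact ⟨x, hx, rfl⟩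

lemma map_proj_pi [DecidableEq ι] (V : ∀ i, Submodule k[X] (M i)) (i : ι) :
    (Submodule.pi Set.univ V).map (LinearMap.proj i) = V i := by
  ext x
  constructor
  · rintro ⟨y, hy, rfl⟩
    exact hy i trivial
  · intro hx
    refine ⟨Pi.single i x, ?_, ?_⟩
    · intro j _
      by_cases hj : j = i
      · subst hj
        rw [Pi.single_eq_same]; exact hx
      · rw [Pi.single_eq_of_ne hj]; exact (V j).zero_mem
    · change (Pi.single i x : ∀ i, M i) i = x
      rw [Pi.single_eq_same]

lemma type_pi_sub [DecidableEq ι] {p : k[X]} (V : ∀ i, Submodule k[X] (M i)) (i : ι) {l : Multiset ℕ+}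
    (h : HasType p (V i) l) (h0 : ∀ j, j ≠ i → HasType p (V j) 0) :
    HasType p (Submodule.pi Set.univ V) l := by
  let E : (∀ j, V j) ≃ₗ[k[X]] (Submodule.pi Set.univ V) :=
    { toFun := fun x => ⟨fun i => (x i).1, fun i _ => (x i).2⟩
      invFun := fun x i => ⟨x.1 i, x.2 i trivial⟩
      map_add' := fun _ _ => rfl
      map_smul' := fun _ _ => rfl
      left_inv := fun _ => rfl
      right_inv := fun _ => rfl }
  have h1 := HasType.pi (p := p) (fun j => V j) (fun j => if j = i then l else 0) (by
    intro j
    by_cases hj : j = i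
    · subst hj; simpa using h
    · simpa [hj] using h0 j hj)
  rw [Finset.sum_ite_eq' Finset.univ i (fun _ => l), if_pos (Finset.mem_univ i)] at h1
  exact HasType.congr E h1

lemma type_pi_quot [DecidableEq ι] {p : k[X]} (V : ∀ i, Submodule k[X] (M i)) (i : ι) {l : Multiset ℕ+}
    (h : HasType p (M i ⧸ V i) l) (h0 : ∀ j, j ≠ i → HasType p (M j ⧸ V j) 0) :
    HasType p ((∀ j, M j) ⧸ (Submodule.pi Set.univ V)) l := by
  have h1 := HasType.pi (p := p) (fun j => M j ⧸ V j) (fun j => if j = i then l else 0) (by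
    intro j
    by_cases hj : j = i
    · subst hj; simpa using h
    · simpa [hj] using h0 j hj)
  rw [Finset.sum_ite_eq' Finset.univ i (fun _ => l), if_pos (Finset.mem_univ i)] at h1
  exact HasType.congr (Submodule.quotientPi V).symm h1

lemma count_pi [DecidableEq ι] [Finite k] [∀ i, Finite (M i)] (hP : ∀ i, MI (P i))
    (hinj : Function.Injective P) {n : ℕ}
    (hn : ∀ i (x : M i), P i ^ n • x = 0) (C : (ι → Multiset ℕ+) → (ι → Multiset ℕ+) → Prop) :
    Nat.card {U : Submodule k[X] (∀ i, M i) //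
      C (fun i => typ (P i) U) (fun i => typ (P i) ((∀ i, M i) ⧸ U))} =
    Nat.card {V : ∀ i, Submodule k[X] (M i) //
      C (fun i => typ (P i) (V i)) (fun i => typ (P i) (M i ⧸ V i))} := by
  have hfin : ∀ U : Submodule k[X] (∀ i, M i), Finite ((∀ i, M i) ⧸ U) :=
    fun U => Finite.of_surjective _ (Submodule.mkQ_surjective U)
  have hfin' : ∀ i (U : Submodule k[X] (M i)), Finite (M i ⧸ U) :=
    fun i U => Finite.of_surjective _ (Submodule.mkQ_surjective U)
  symm
  have h0 : ∀ i j, j ≠ i → HasType (P i) (M j) 0 := by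
    intro i j hj
    exact HasType.zero_of_kill (((hP i).coprime (hP j) (fun h => hj (hinj h).symm)).pow_right (n := n)) (hn j)
  have e1 : ∀ (V : ∀ i, Submodule k[X] (M i)) i,
      typ (P i) (Submodule.pi Set.univ V) = typ (P i) (V i) := by
    intro V i
    apply typ_eq (hP i)
    exact type_pi_sub V i (hasType_typ _ (hP i)) (fun j hj => (h0 i j hj).zero_sub _)
  have e2 : ∀ (V : ∀ i, Submodule k[X] (M i)) i,
      typ (P i) ((∀ i, M i) ⧸ Submodule.pi Set.univ V) = typ (P i) (M i ⧸ V i) := by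
    intro V i
    apply typ_eq (hP i)
    exact type_pi_quot V i (hasType_typ _ (hP i)) (fun j hj => (h0 i j hj).zero_quot _)
  refine Nat.card_congr (Equiv.subtypeEquiv
    ⟨fun V => Submodule.pi Set.univ V, fun U i => U.map (LinearMap.proj i),
      fun V => funext (fun i => map_proj_pi V i), fun U => sub_pi hP hinj hn U⟩ ?_)
  intro V
  simp only [Equiv.coe_fn_mk, e1, e2]

lemma count_iso [Finite k] {T T' : Type} [AddCommGroup T] [Module k[X] T] [AddCommGroup T']
    [Module k[X] T'] [Finite T] [Finite T'] (E : T ≃ₗ[k[X]] T') (hP : ∀ i, MI (P i))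
    (C : (ι → Multiset ℕ+) → (ι → Multiset ℕ+) → Prop) :
    Nat.card {U : Submodule k[X] T // C (fun i => typ (P i) U) (fun i => typ (P i) (T ⧸ U))} =
    Nat.card {U : Submodule k[X] T' // C (fun i => typ (P i) U) (fun i => typ (P i) (T' ⧸ U))} := by
  have hfin : ∀ U : Submodule k[X] T, Finite (T ⧸ U) :=
    fun U => Finite.of_surjective _ (Submodule.mkQ_surjective U)
  have hfin' : ∀ U : Submodule k[X] T', Finite (T' ⧸ U) :=
    fun U => Finite.of_surjective _ (Submodule.mkQ_surjective U)
  refine Nat.card_congr (Equiv.subtypeEquiv (Submodule.orderIsoMapComap E).toEquiv ?_)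
  intro U
  have e1 : ∀ i, typ (P i) U = typ (P i) (U.map E.toLinearMap) := fun i =>
    typ_congr (E.submoduleMap U) (hP i)
  have e2 : ∀ i, typ (P i) (T ⧸ U) = typ (P i) (T' ⧸ U.map E.toLinearMap) := fun i =>
    typ_congr (Submodule.Quotient.equiv U (U.map E.toLinearMap) E rfl) (hP i)
  simp only [e1, e2]
  rfl

/-- the `P`-primary module of type `l` -/
abbrev Prim (P : k[X]) (l : Multiset ℕ+) : Type :=
  ∀ j : Fin l.toList.length, k[X] ⧸ Ideal.span {P ^ ((l.toList.get j : ℕ+) : ℕ)}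

lemma prim_finite [Finite k] {P : k[X]} (hP : MI P) (l : Multiset ℕ+) : Finite (Prim P l) := by
  have : ∀ j : Fin l.toList.length, Finite (k[X] ⧸ Ideal.span {P ^ ((l.toList.get j : ℕ+) : ℕ)}) :=
    fun j => finite_quot (pow_ne_zero _ hP.2.ne_zero)
  infer_instance

lemma sum_get (L : List ℕ+) : ∑ j : Fin L.length, ({L.get j} : Multiset ℕ+) = (L : Multiset ℕ+) := by
  induction L with
  | nil => rfl
  | cons a L ih =>
    have h := Fin.sum_univ_succ (n := L.length)
      (fun j : Fin (L.length + 1) => ({(a :: L).get j} : Multiset ℕ+))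
    refine h.trans ?_
    simp only [List.get_cons_zero, List.get_cons_succ']
    rw [ih, Multiset.singleton_add, Multiset.cons_coe]

lemma prim_type {P : k[X]} (hP : MI P) (l : Multiset ℕ+) : HasType P (Prim P l) l := by
  have h := HasType.pi (p := P) (fun j : Fin l.toList.length => k[X] ⧸ Ideal.span {P ^ ((l.toList.get j : ℕ+) : ℕ)})
    (fun j => {l.toList.get j}) (fun j => HasType.quot_pow hP.max hP.2.ne_zero _)
  rwa [sum_get, Multiset.coe_toList] at h

lemma prim_kill (P : k[X]) (l : Multiset ℕ+) : ∃ n, ∀ m, n ≤ m → ∀ x : Prim P l, P ^ m • x = 0 := by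
  refine ⟨∑ j : Fin l.toList.length, ((l.toList.get j : ℕ+) : ℕ), fun m hm x => ?_⟩
  funext j
  obtain ⟨y, hy⟩ := Ideal.Quotient.mk_surjective (x j)
  rw [Pi.smul_apply, ← hy]
  change Ideal.Quotient.mk _ (P ^ m * y) = 0
  rw [Ideal.Quotient.eq_zero_iff_mem, Ideal.mem_span_singleton]
  refine (pow_dvd_pow P ?_).mul_right y
  exact le_trans (Finset.single_le_sum (f := fun j : Fin l.toList.length => ((l.toList.get j : ℕ+) : ℕ))
    (fun _ _ => Nat.zero_le _) (Finset.mem_univ j)) hm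

end kt

theorem count_thm (ι : Type) [Fintype ι] (lam : ι → Multiset ℕ+) (d : ι → ℕ)
    (C : (ι → Multiset ℕ+) → (ι → Multiset ℕ+) → Prop) :
    ∃ F : ℤ[X], ∀ (k : Type) [Field k] [Fintype k] (P : ι → k[X]), (∀ i, MI (P i)) →
      Function.Injective P → (∀ i, (P i).natDegree = d i) →
      ∀ (T : Type) [AddCommGroup T] [Module k[X] T] [Finite T],
      (∀ i, HasType (P i) T (lam i)) → (∀ p, MI p → (∀ i, P i ≠ p) → HasType p T 0) →
      (Nat.card {U : Submodule k[X] T //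
        C (fun i => typ (P i) U) (fun i => typ (P i) (T ⧸ U))} : ℤ) =
        F.eval (Fintype.card k : ℤ) := by
  classical
  choose PH hPH using hall_poly
  have hS : ∀ i, {b : Multiset ℕ+ | gOf b ≤ gOf (lam i)}.Finite := fun i =>
    (Set.finite_Iic (gOf (lam i))).preimage gOf_inj.injOn
  let S : ι → Finset (Multiset ℕ+) := fun i => (hS i).toFinset
  let B := (Fintype.piFinset S) ×ˢ (Fintype.piFinset S)
  refine ⟨∑ y ∈ B, (∏ i, (PH (gOf (y.2 i)) (gOf (y.1 i)) (gOf (lam i))).comp (X ^ d i)) *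
    (if C y.1 y.2 then 1 else 0), ?_⟩
  intro k _ _ P hP hinj hd T _ _ _ hT hT0
  have hPfin : ∀ i, Finite (Prim (P i) (lam i)) := fun i => prim_finite (hP i) (lam i)
  have hkill : ∃ n, ∀ i (x : Prim (P i) (lam i)), P i ^ n • x = 0 := by
    choose n hn using fun i => prim_kill (P i) (lam i)
    exact ⟨∑ i, n i, fun i x => hn i _
      (Finset.single_le_sum (fun _ _ => Nat.zero_le _) (Finset.mem_univ i)) x⟩
  obtain ⟨n, hn⟩ := hkill
  have hHT : ∀ i, HT (P i) (Prim (P i) (lam i)) (gOf (lam i)) := fun i =>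
    (prim_type (hP i) (lam i)).toHT (hn i)
  obtain ⟨E⟩ : Nonempty (T ≃ₗ[k[X]] (∀ i, Prim (P i) (lam i))) := by
    apply iso_of_types
    intro p hp l hl
    by_cases hr : ∃ i, P i = p
    · obtain ⟨i, rfl⟩ := hr
      have : l = lam i := hl.unique hp.one_lt (hT i)
      subst this
      have h1 := HasType.pi (p := P i) (fun j => Prim (P j) (lam j))
        (fun j => if j = i then lam i else 0) (by
          intro j
          by_cases hj : j = i
          · subst hj; simpa using prim_type (hP j) (lam j)
          · simp only [hj, if_false]
            exact HasType.zero_of_kill (((hP i).coprime (hP j)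
              (fun h => hj (hinj h).symm)).pow_right (n := n)) (hn j))
      rwa [Finset.sum_ite_eq' Finset.univ i (fun _ => lam i), if_pos (Finset.mem_univ i)] at h1
    · push Not at hr
      have : l = 0 := hl.unique hp.one_lt (hT0 p hp hr)
      subst this
      have h1 := HasType.pi (p := p) (fun j => Prim (P j) (lam j)) (fun _ => 0) (by
          intro j
          exact HasType.zero_of_kill ((hp.coprime (hP j)
              (hr j).symm).pow_right (n := n)) (hn j))
      simpa using h1
  rw [count_iso E hP, count_pi hP hinj hn]
  let _ : Fintype (∀ i, Submodule k[X] (Prim (P i) (lam i))) := Fintype.ofFinite _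
  have hsb := sum_by_type (fun V : ∀ i, Submodule k[X] (Prim (P i) (lam i)) =>
    ((fun i => typ (P i) (V i), fun i => typ (P i) (Prim (P i) (lam i) ⧸ V i)) :
      (ι → Multiset ℕ+) × (ι → Multiset ℕ+))) B (fun y => if C y.1 y.2 then 1 else 0) (by
    intro V hV
    exfalso
    apply hV
    rw [Finset.mem_product, Fintype.mem_piFinset, Fintype.mem_piFinset]
    constructor
    · intro i
      rw [Set.Finite.mem_toFinset]
      refine HT_sub_le (hP i).one_lt (hHT i) (U := V i) ?_
      exact (hasType_typ _ (hP i)).toHT (n := n) (by rintro ⟨x, hx⟩; ext1; exact hn i x)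
    · intro i
      rw [Set.Finite.mem_toFinset]
      have hfin : Finite (Prim (P i) (lam i) ⧸ V i) :=
        Finite.of_surjective _ (Submodule.mkQ_surjective (V i))
      refine HT_quot_le (hP i).one_lt (hHT i) (U := V i) ?_
      exact (hasType_typ _ (hP i)).toHT (n := n) (by
        intro z
        obtain ⟨z, rfl⟩ := Submodule.mkQ_surjective _ z
        rw [← map_smul, hn, map_zero]))
  rw [Finset.sum_boole] at hsb
  rw [Nat.card_eq_fintype_card, Fintype.card_subtype]
  refine Eq.trans ?_ (hsb.trans ?_)
  · rfl
  rw [eval_finset_sum]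
  apply Finset.sum_congr rfl
  rintro ⟨a, b⟩ _
  rw [eval_mul]
  congr 1
  swap
  · simp only; split_ifs <;> simp
  rw [eval_prod]
  have h1 : Nat.card {V : ∀ i, Submodule k[X] (Prim (P i) (lam i)) //
      ((fun i => typ (P i) (V i), fun i => typ (P i) (Prim (P i) (lam i) ⧸ V i)) :
      (ι → Multiset ℕ+) × (ι → Multiset ℕ+)) = (a, b)} =
      Nat.card (∀ i, {V : Submodule k[X] (Prim (P i) (lam i)) // HT (P i) V (gOf (a i)) ∧
        HT (P i) (Prim (P i) (lam i) ⧸ V) (gOf (b i))}) := by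
    have hiff : ∀ i (V : Submodule k[X] (Prim (P i) (lam i))),
        (typ (P i) V = a i ∧ typ (P i) (Prim (P i) (lam i) ⧸ V) = b i) ↔ (HT (P i) V (gOf (a i)) ∧
        HT (P i) (Prim (P i) (lam i) ⧸ V) (gOf (b i))) := by
      intro i V
      have hfin : Finite (Prim (P i) (lam i) ⧸ V) :=
        Finite.of_surjective _ (Submodule.mkQ_surjective V)
      rw [← typ_iff (hP i), ← typ_iff (hP i)]
      constructor
      · rintro ⟨h1, h2⟩
        refine ⟨h1.toHT (n := n) (by rintro ⟨x, hx⟩; ext1; exact hn i x), h2.toHT (n := n) ?_⟩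
        intro z
        obtain ⟨z, rfl⟩ := Submodule.mkQ_surjective _ z
        rw [← map_smul, hn, map_zero]
      · rintro ⟨h1, h2⟩
        exact ⟨HasType.of_HT h1, HasType.of_HT h2⟩
    refine Nat.card_congr ⟨fun V i => ⟨V.1 i, (hiff i _).1 ⟨congrFun (Prod.mk.inj V.2).1 i,
      congrFun (Prod.mk.inj V.2).2 i⟩⟩,
      fun V => ⟨fun i => (V i).1, Prod.ext (funext fun i => ((hiff i _).2 (V i).2).1)
        (funext fun i => ((hiff i _).2 (V i).2).2)⟩, fun _ => rfl, fun _ => rfl⟩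
  rw [h1, Nat.card_pi]
  push_cast
  apply Finset.prod_congr rfl
  intro i _
  have hf := (hP i).fin
  rw [hPH (gOf (b i)) (gOf (a i)) (gOf (lam i)) k[X] (P i) (hP i).max _ (hHT i), eval_comp,
    (hP i).qq, hd i]
  simp

end SegreHall

namespace SegreHall

/-- numerical shadow of data -/
noncomputable def shad {k : Type} [Field k] (m : Multiset (Multiset ℕ+ × k[X])) :
    Multiset (Multiset ℕ+ × ℕ) := m.map (fun x => (x.1, x.2.natDegree))

open Classical in
/-- collecting nonzero types -/
noncomputable def dat {ι β : Type} [Fintype ι] (P : ι → β) (a : ι → Multiset ℕ+) :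
    Multiset (Multiset ℕ+ × β) :=
  ((Finset.univ : Finset ι).val.map (fun i => (a i, P i))).filter (fun x => x.1 ≠ 0)

lemma dat_map {ι β γ : Type} [Fintype ι] (P : ι → β) (a : ι → Multiset ℕ+) (g : β → γ) :
    (dat P a).map (fun x => (x.1, g x.2)) = dat (fun i => g (P i)) a := by
  classical
  rw [dat, dat, Multiset.filter_map, Multiset.filter_map, Multiset.map_map]
  rfl

lemma mem_dat {ι β : Type} [Fintype ι] {P : ι → β} {a : ι → Multiset ℕ+} {l : Multiset ℕ+} {p : β} :
    (l, p) ∈ dat P a ↔ l ≠ 0 ∧ ∃ i, a i = l ∧ P i = p := by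
  classical
  rw [dat, Multiset.mem_filter, Multiset.mem_map]
  simp [and_comm]

lemma enum_lemma {α β ι : Type*} [DecidableEq ι] (f : α → β) (t : ι → β) (a0 : ι → α)
    (s : Finset ι) : ∀ m : Multiset α,
    m.map f = s.val.map t → ∃ a : ι → α, s.val.map a = m ∧ ∀ i ∈ s, f (a i) = t i := by
  induction s using Finset.induction_on with
  | empty =>
    intro m hm
    refine ⟨a0, ?_, by simp⟩
    have h0 : m = 0 := by simpa using hm
    rw [h0]; rfl
  | insert i s hi ih =>
    intro m hm
    rw [Finset.insert_val_of_notMem hi, Multiset.map_cons] at hm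
    obtain ⟨x, hx, h1, h2⟩ : ∃ x ∈ m, f x = t i ∧ True := by
      have : t i ∈ m.map f := by rw [hm]; exact Multiset.mem_cons_self _ _
      obtain ⟨x, hx, h⟩ := Multiset.mem_map.1 this
      exact ⟨x, hx, h, trivial⟩
    obtain ⟨m', rfl⟩ := Multiset.exists_cons_of_mem hx
    rw [Multiset.map_cons, h1, Multiset.cons_inj_right] at hm
    obtain ⟨a, ha1, ha2⟩ := ih m' hm
    refine ⟨Function.update a i x, ?_, ?_⟩
    · rw [Finset.insert_val_of_notMem hi, Multiset.map_cons, Function.update_self]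
      congr 1
      rw [← ha1]
      apply Multiset.map_congr rfl
      intro j hj
      rw [Function.update_of_ne]
      rintro rfl
      exact hi hj
    · intro j hj
      by_cases hji : j = i
      · subst hji
        rw [Function.update_self, h1]
      · rw [Function.update_of_ne hji]
        exact ha2 j (Finset.mem_of_mem_insert_of_ne hj hji)

section kt
variable {k : Type} [Field k]

/-- `m` is the classifying data of the finite module `M` -/
structure IsData (M : Type) [AddCommGroup M] [Module k[X] M]
    (m : Multiset (Multiset ℕ+ × k[X])) : Prop where
  fin : Finite M
  mi : ∀ x ∈ m, MI x.2
  ne : ∀ x ∈ m, x.1 ≠ 0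
  nodup : (m.map Prod.snd).Nodup
  mem : ∀ l p, l ≠ 0 → MI p → ((l, p) ∈ m ↔ HasType p M l)

variable {M : Type} [AddCommGroup M] [Module k[X] M]
variable {N : Type} [AddCommGroup N] [Module k[X] N]
variable {m m' : Multiset (Multiset ℕ+ × k[X])}

lemma IsData.congr (e : M ≃ₗ[k[X]] N) (h : IsData M m) : IsData N m := by
  refine ⟨?_, h.mi, h.ne, h.nodup, ?_⟩
  · have := h.fin
    exact Finite.of_equiv M e.toEquiv
  · intro l p hl hp
    rw [h.mem l p hl hp]
    exact ⟨HasType.congr e, HasType.congr e.symm⟩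

lemma IsData.unique (h : IsData M m) (h' : IsData M m') : m = m' := by
  rw [Multiset.Nodup.ext h.nodup.of_map h'.nodup.of_map]
  rintro ⟨l, p⟩
  constructor
  · intro hx
    have h1 := h.mi _ hx
    have h2 := h.ne _ hx
    exact (h'.mem l p h2 h1).2 ((h.mem l p h2 h1).1 hx)
  · intro hx
    have h1 := h'.mi _ hx
    have h2 := h'.ne _ hx
    exact (h.mem l p h2 h1).2 ((h'.mem l p h2 h1).1 hx)

lemma IsData.iso [Finite k] (h : IsData M m) (h' : IsData N m) : Nonempty (M ≃ₗ[k[X]] N) := by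
  have := h.fin
  have := h'.fin
  apply iso_of_types
  intro p hp l hl
  by_cases h0 : l = 0
  · subst h0
    have h1 := hasType_typ N hp
    by_cases h2 : typ p N = 0
    · rwa [h2] at h1
    · have h3 := (h.mem _ p h2 hp).1 ((h'.mem _ p h2 hp).2 h1)
      exact absurd (h3.unique hp.one_lt hl) h2
  · exact (h'.mem l p h0 hp).1 ((h.mem l p h0 hp).2 hl)

open Classical in
lemma segre_type (L : List (List ℕ+ × k[X])) (hL : ∀ x ∈ L, MI x.2) {p : k[X]} (hp : MI p) :
    HasType p (segreModule k L) (∑ i, if (L.get i).2 = p then ((L.get i).1 : Multiset ℕ+) else 0) := by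
  apply HasType.pi
  intro i
  have h := HasType.pi (p := p) (fun j : Fin (L.get i).1.length =>
      k[X] ⧸ Ideal.span {((L.get i).2) ^ ((((L.get i).1.get j) : ℕ+) : ℕ)})
    (fun j => if (L.get i).2 = p then {(L.get i).1.get j} else 0)
    (fun j => type_quot hp (hL _ (List.get_mem _ _)) _)
  by_cases hc : (L.get i).2 = p
  · simp only [hc, if_true] at h ⊢
    rwa [sum_get] at h
  · simp only [hc, if_false, Finset.sum_const_zero] at h ⊢
    exact h

lemma segre_isData [Finite k] (L : List (List ℕ+ × k[X])) (hL : ∀ x ∈ L, MI x.2)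
    (hne : ∀ x ∈ L, x.1 ≠ []) (hnd : (L.map Prod.snd).Nodup) :
    IsData (segreModule k L) ((L.map (fun x => ((x.1 : Multiset ℕ+), x.2)) : List (Multiset ℕ+ × k[X])) : Multiset (Multiset ℕ+ × k[X])) := by
  classical
  have hfin : Finite (segreModule k L) := by
    have : ∀ i : Fin L.length, ∀ j : Fin (L.get i).1.length,
      Finite (k[X] ⧸ Ideal.span {((L.get i).2) ^ ((((L.get i).1.get j) : ℕ+) : ℕ)}) := fun i j =>
      finite_quot (pow_ne_zero _ (hL _ (List.get_mem _ _)).2.ne_zero)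
    infer_instance
  have hinj : ∀ i j : Fin L.length, (L.get i).2 = (L.get j).2 → i = j := by
    intro i j h
    have h1 := List.nodup_iff_injective_get.1 hnd
    have h2 := @h1 ⟨i, by simp⟩ ⟨j, by simp⟩ (by simpa using h)
    exact Fin.ext (by simpa using h2)
  have key : ∀ i : Fin L.length, HasType (L.get i).2 (segreModule k L) ((L.get i).1 : Multiset ℕ+) := by
    intro i
    have h := segre_type L hL (hL _ (List.get_mem L i))
    rwa [Finset.sum_eq_single i, if_pos rfl] at h
    · intro j _ hj
      rw [if_neg (fun hc => hj (hinj j i hc))]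
    · intro hc; exact absurd (Finset.mem_univ i) hc
  refine ⟨hfin, ?_, ?_, ?_, ?_⟩
  · intro x hx
    rw [Multiset.mem_coe, List.mem_map] at hx
    obtain ⟨y, hy, rfl⟩ := hx
    exact hL y hy
  · intro x hx
    rw [Multiset.mem_coe, List.mem_map] at hx
    obtain ⟨y, hy, rfl⟩ := hx
    simpa using hne y hy
  · rw [Multiset.map_coe, Multiset.coe_nodup, List.map_map]
    exact hnd
  · intro l p hl hp
    rw [Multiset.mem_coe, List.mem_map]
    constructor
    · rintro ⟨y, hy, hyx⟩
      obtain ⟨i, rfl⟩ := List.mem_iff_get.1 hy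
      obtain ⟨rfl, rfl⟩ := Prod.mk.inj hyx
      exact key i
    · intro h
      by_cases hex : ∃ i : Fin L.length, (L.get i).2 = p
      · obtain ⟨i, rfl⟩ := hex
        exact ⟨L.get i, List.get_mem L i, Prod.ext ((key i).unique hp.one_lt h) rfl⟩
      · push Not at hex
        have h1 := segre_type L hL hp
        rw [Finset.sum_eq_zero (fun i _ => if_neg (hex i))] at h1
        exact absurd (h.unique hp.one_lt h1) hl

lemma moduleOfData_isData [Finite k] (h1 : ∀ x ∈ m, MI x.2) (h2 : ∀ x ∈ m, x.1 ≠ 0)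
    (h3 : (m.map Prod.snd).Nodup) :
    IsData (segreModule k (dataList k m)) m := by
  have h := segre_isData (dataList k m) (by
      intro x hx
      obtain ⟨y, hy, rfl⟩ := List.mem_map.1 hx
      exact h1 y (Multiset.mem_toList.1 hy)) (by
      intro x hx
      obtain ⟨y, hy, rfl⟩ := List.mem_map.1 hx
      simpa using h2 y (Multiset.mem_toList.1 hy)) (by
      rw [dataList, List.map_map]
      rw [← Multiset.coe_toList m, Multiset.map_coe, Multiset.coe_nodup] at h3
      exact h3)
  convert h
  rw [dataList, List.map_map]
  conv_lhs => rw [← Multiset.coe_toList m]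
  congr 1
  have : ∀ x : Multiset ℕ+ × k[X], ((x.1.toList : Multiset ℕ+), x.2) = x := by
    intro x; rw [Multiset.coe_toList]
  symm
  conv_rhs => rw [← List.map_id m.toList]
  apply List.map_congr_left
  intro x _
  exact this x

lemma moduleOfData_isData2 [Finite k] (h1 : ∀ x ∈ m, MI x.2) (h2 : ∀ x ∈ m, x.1 ≠ 0)
    (h3 : (m.map Prod.snd).Nodup) :
    IsData (moduleOfData k m) m := moduleOfData_isData h1 h2 h3

lemma shad_ne {σ : Multiset (Multiset ℕ+ × ℕ)} (hσ : ∀ p ∈ σ, p.1 ≠ 0 ∧ 0 < p.2)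
    (h : shad m = σ) : ∀ x ∈ m, x.1 ≠ 0 := by
  intro x hx
  have h1 : (x.1, x.2.natDegree) ∈ σ := by
    rw [← h]; exact Multiset.mem_map_of_mem (fun x : Multiset ℕ+ × k[X] => (x.1, x.2.natDegree)) hx
  exact (hσ _ h1).1

lemma inSegre_iff [Finite k] {σ : Multiset (Multiset ℕ+ × ℕ)} (hσ : ∀ p ∈ σ, p.1 ≠ 0 ∧ 0 < p.2) :
    InSegreClass σ k M ↔ ∃ m : Multiset (Multiset ℕ+ × k[X]), shad m = σ ∧ IsData M m := by
  constructor
  · rintro ⟨L, h1, h2, h3, ⟨E⟩⟩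
    refine ⟨((L.map (fun x => ((x.1 : Multiset ℕ+), x.2)) : List (Multiset ℕ+ × k[X])) : Multiset (Multiset ℕ+ × k[X])), ?_, ?_⟩
    · rw [← h3, shad, Multiset.map_coe, List.map_map]; rfl
    · refine IsData.congr E.symm (segre_isData L h1 ?_ h2)
      intro x hx h0
      have : ((x.1 : Multiset ℕ+), x.2.natDegree) ∈ σ := by
        rw [← h3, Multiset.mem_coe, List.mem_map]
        exact ⟨x, hx, rfl⟩
      exact (hσ _ this).1 (by rw [h0]; rfl)
  · rintro ⟨m, h1, h2⟩
    have hd := moduleOfData_isData h2.mi h2.ne h2.nodup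
    obtain ⟨E⟩ := h2.iso hd
    refine ⟨dataList k m, ?_, ?_, ?_, ⟨E⟩⟩
    · intro x hx
      obtain ⟨y, hy, rfl⟩ := List.mem_map.1 hx
      exact h2.mi y (Multiset.mem_toList.1 hy)
    · have h3 := h2.nodup
      rw [dataList, List.map_map]
      rw [← Multiset.coe_toList m, Multiset.map_coe, Multiset.coe_nodup] at h3
      exact h3
    · rw [dataList, List.map_map, ← h1, shad]
      conv_rhs => rw [← Multiset.coe_toList m]
      rw [Multiset.map_coe]
      congr 1
      apply List.map_congr_left
      intro x _
      simp

variable {ι : Type} [Fintype ι] {P : ι → k[X]}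

lemma isData_dat [Finite k] (hP : ∀ i, MI (P i)) (hinj : Function.Injective P) [Finite N]
    (h0 : ∀ p, MI p → (∀ i, P i ≠ p) → HasType p N 0) :
    IsData N (dat P (fun i => typ (P i) N)) := by
  classical
  refine ⟨inferInstance, ?_, ?_, ?_, ?_⟩
  · rintro ⟨l, p⟩ hx
    obtain ⟨_, i, _, rfl⟩ := mem_dat.1 hx
    exact hP i
  · rintro ⟨l, p⟩ hx
    exact (mem_dat.1 hx).1
  · refine Multiset.nodup_of_le (Multiset.map_le_map (Multiset.filter_le _ _)) ?_
    rw [Multiset.map_map]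
    exact Multiset.Nodup.map hinj Finset.univ.nodup
  · intro l p hl hp
    rw [mem_dat]
    constructor
    · rintro ⟨_, i, rfl, rfl⟩
      exact hasType_typ N hp
    · intro h
      refine ⟨hl, ?_⟩
      by_cases hex : ∃ i, P i = p
      · obtain ⟨i, rfl⟩ := hex
        exact ⟨i, typ_eq hp h, rfl⟩
      · push Not at hex
        exact absurd (h.unique hp.one_lt (h0 p hp hex)) hl

/-- Unfolding data of a module along an enumeration. -/
lemma IsData.typed [Finite k] {lam : ι → Multiset ℕ+}
    (h : IsData M ((Finset.univ : Finset ι).val.map (fun i => (lam i, P i)))) :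
    (∀ i, MI (P i)) ∧ Function.Injective P ∧ (∀ i, HasType (P i) M (lam i)) ∧
      (∀ p, MI p → (∀ i, P i ≠ p) → HasType p M 0) := by
  have hmem : ∀ i, (lam i, P i) ∈ ((Finset.univ : Finset ι).val.map (fun i => (lam i, P i))) :=
    fun i => Multiset.mem_map.2 ⟨i, Finset.mem_univ i, rfl⟩
  have hP : ∀ i, MI (P i) := fun i => h.mi _ (hmem i)
  refine ⟨hP, ?_, ?_, ?_⟩
  · have h1 := h.nodup
    rw [Multiset.map_map] at h1
    intro i j hij
    exact Multiset.inj_on_of_nodup_map h1 i (Finset.mem_univ i) j (Finset.mem_univ j) hij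
  · intro i
    exact (h.mem _ _ (h.ne _ (hmem i)) (hP i)).1 (hmem i)
  · intro p hp hne
    have := h.fin
    have h1 := hasType_typ M hp
    by_cases h2 : typ p M = 0
    · rwa [h2] at h1
    · obtain ⟨i, _, hi⟩ := Multiset.mem_map.1 ((h.mem _ _ h2 hp).2 h1)
      exact absurd (Prod.mk.inj hi).2 (hne i)

open Classical in
/-- the data of a module -/
noncomputable def dataOf (k : Type) [Field k] (M : Type) [AddCommGroup M] [Module k[X] M] :
    Multiset (Multiset ℕ+ × k[X]) :=
  if h : ∃ m, IsData M m then h.choose else 0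

lemma dataOf_eq (h : IsData M m) : dataOf k M = m := by
  have h' : ∃ m, IsData (k := k) M m := ⟨m, h⟩
  rw [dataOf, dif_pos h']
  exact h'.choose_spec.unique h

end kt

/-- Main counting statement in terms of data. -/
theorem count_data (ι : Type) [Fintype ι] (lam : ι → Multiset ℕ+) (d : ι → ℕ)
    (C : (ι → Multiset ℕ+) → (ι → Multiset ℕ+) → Prop) :
    ∃ F : ℤ[X], ∀ (k : Type) [Field k] [Fintype k] (P : ι → k[X]),
      (∀ i, (P i).natDegree = d i) →
      ∀ (T : Type) [AddCommGroup T] [Module k[X] T],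
      IsData T ((Finset.univ : Finset ι).val.map (fun i => (lam i, P i))) →
      ∀ D : Multiset (Multiset ℕ+ × k[X]) → Multiset (Multiset ℕ+ × k[X]) → Prop,
      (∀ a b, D (dat P a) (dat P b) ↔ C a b) →
      (Nat.card {U : Submodule k[X] T // D (dataOf k U) (dataOf k (T ⧸ U))} : ℤ) =
        F.eval (Fintype.card k : ℤ) := by
  obtain ⟨F, hF⟩ := count_thm ι lam d C
  refine ⟨F, ?_⟩
  intro k _ _ P hd T _ _ hT D hD
  obtain ⟨h1, h2, h3, h4⟩ := hT.typed
  have hfin := hT.fin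
  rw [← hF k P h1 h2 hd T h3 h4]
  congr 1
  apply Nat.card_congr
  apply Equiv.subtypeEquivRight
  intro U
  have hfin' : Finite (T ⧸ U) := Finite.of_surjective _ (Submodule.mkQ_surjective U)
  rw [dataOf_eq (isData_dat h1 h2 (fun p hp hne => (h4 p hp hne).zero_sub U)),
    dataOf_eq (isData_dat h1 h2 (fun p hp hne => (h4 p hp hne).zero_quot U)), hD]

section kt
variable {k : Type} [Field k]

lemma exists_data [Finite k] (M : Type) [AddCommGroup M] [Module k[X] M] [Finite M] :
    ∃ m, IsData (k := k) M m := by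
  classical
  obtain ⟨f⟩ := exists_flat (k := k) M
  let _ := f.fin
  let S : Finset k[X] := Finset.univ.image f.p
  refine ⟨_, isData_dat (ι := S) (P := fun s => s.1) ?_ Subtype.val_injective ?_⟩
  · rintro ⟨s, hs⟩
    obtain ⟨i, _, rfl⟩ := Finset.mem_image.1 hs
    exact f.mi i
  · intro p hp hne
    have h := f.type hp
    rwa [Finset.sum_eq_zero] at h
    intro i _
    rw [if_neg]
    intro hc
    exact hne ⟨f.p i, Finset.mem_image.2 ⟨i, Finset.mem_univ i, rfl⟩⟩ hc

lemma isData_dataOf [Finite k] (M : Type) [AddCommGroup M] [Module k[X] M] [Finite M] :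
    IsData M (dataOf k M) := by
  obtain ⟨m, hm⟩ := exists_data (k := k) M
  rw [dataOf_eq hm]; exact hm

lemma inSegre_iff_shad [Finite k] {M : Type} [AddCommGroup M] [Module k[X] M] [Finite M]
    {σ : Multiset (Multiset ℕ+ × ℕ)} (hσ : ∀ p ∈ σ, p.1 ≠ 0 ∧ 0 < p.2) :
    InSegreClass σ k M ↔ shad (dataOf k M) = σ := by
  rw [inSegre_iff hσ]
  constructor
  · rintro ⟨m, h1, h2⟩
    rwa [dataOf_eq h2]
  · intro h
    exact ⟨_, h, isData_dataOf M⟩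

lemma iso_iff [Finite k] {M N : Type} [AddCommGroup M] [Module k[X] M] [Finite M]
    [AddCommGroup N] [Module k[X] N] [Finite N] :
    Nonempty (M ≃ₗ[k[X]] N) ↔ dataOf k M = dataOf k N := by
  constructor
  · rintro ⟨e⟩
    exact dataOf_eq ((isData_dataOf N).congr e.symm)
  · intro h
    have h1 := isData_dataOf (k := k) M
    rw [h] at h1
    exact h1.iso (isData_dataOf N)

end kt
end SegreHall

namespace SegreHall

/-- index type of a Segre symbol -/
abbrev Ix (τ : Multiset (Multiset ℕ+ × ℕ)) : Type := Fin τ.toList.length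

/-- enumeration of a Segre symbol -/
noncomputable def en (τ : Multiset (Multiset ℕ+ × ℕ)) (i : Ix τ) : Multiset ℕ+ × ℕ := τ.toList.get i

lemma en_map (τ : Multiset (Multiset ℕ+ × ℕ)) :
    (Finset.univ : Finset (Ix τ)).val.map (en τ) = τ := by
  conv_rhs => rw [← Multiset.coe_toList τ]
  rw [Fin.univ_def]
  change ((List.finRange τ.toList.length : Multiset _)).map (en τ) = _
  rw [Multiset.map_coe]
  congr 1
  rw [← List.ofFn_eq_map]
  exact List.ofFn_get τ.toList

section kt
variable {k : Type} [Field k]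

lemma exists_enum {τ : Multiset (Multiset ℕ+ × ℕ)} {m : Multiset (Multiset ℕ+ × k[X])}
    (h : shad m = τ) : ∃ P : Ix τ → k[X],
      m = (Finset.univ : Finset (Ix τ)).val.map (fun i => ((en τ i).1, P i)) ∧
      ∀ i, (P i).natDegree = (en τ i).2 := by
  obtain ⟨a, h1, h2⟩ := enum_lemma (fun x : Multiset ℕ+ × k[X] => (x.1, x.2.natDegree)) (en τ)
    (fun _ => (0, 0)) (Finset.univ : Finset (Ix τ)) m (by rw [en_map]; exact h)
  refine ⟨fun i => (a i).2, ?_, ?_⟩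
  · rw [← h1]
    apply Multiset.map_congr rfl
    intro i _
    rw [← h2 i (Finset.mem_univ i)]
  · intro i
    rw [← h2 i (Finset.mem_univ i)]

/-- admissible permutations of polynomials -/
structure Good (π : Equiv.Perm k[X]) : Prop where
  mi : ∀ p, MI (π p) ↔ MI p
  deg : ∀ p, (π p).natDegree = p.natDegree

lemma Good.one : Good (1 : Equiv.Perm k[X]) := ⟨fun _ => Iff.rfl, fun _ => rfl⟩

lemma Good.mul {π π' : Equiv.Perm k[X]} (h : Good π) (h' : Good π') : Good (π * π') :=
  ⟨fun p => (h.mi _).trans (h'.mi _), fun p => (h.deg _).trans (h'.deg _)⟩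

lemma Good.inv {π : Equiv.Perm k[X]} (h : Good π) : Good π⁻¹ := by
  have hpi : ∀ p, π (π⁻¹ p) = p := fun p => Equiv.apply_symm_apply π p
  refine ⟨fun p => ?_, fun p => ?_⟩
  · rw [← h.mi (π⁻¹ p), hpi p]
  · rw [← h.deg (π⁻¹ p), hpi p]

lemma Good.swap [DecidableEq k[X]] {a b : k[X]} (ha : MI a) (hb : MI b)
    (h : a.natDegree = b.natDegree) :
    Good (Equiv.swap a b) := by
  have key : ∀ p, (MI (Equiv.swap a b p) ↔ MI p) ∧ (Equiv.swap a b p).natDegree = p.natDegree := by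
    intro p
    rw [Equiv.swap_apply_def]
    split_ifs with h1 h2
    · subst h1; exact ⟨⟨fun _ => ha, fun _ => hb⟩, h.symm⟩
    · subst h2; exact ⟨⟨fun _ => hb, fun _ => ha⟩, h⟩
    · exact ⟨Iff.rfl, rfl⟩
  exact ⟨fun p => (key p).1, fun p => (key p).2⟩

lemma exists_good {ι : Type} [DecidableEq ι] (P P' : ι → k[X]) (hP : ∀ i, MI (P i))
    (hP' : ∀ i, MI (P' i)) (hi : Function.Injective P) (hi' : Function.Injective P')
    (hd : ∀ i, (P i).natDegree = (P' i).natDegree) (s : Finset ι) :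
    ∃ π : Equiv.Perm k[X], Good π ∧ ∀ i ∈ s, π (P i) = P' i := by
  classical
  induction s using Finset.induction_on with
  | empty => exact ⟨1, Good.one, by simp⟩
  | insert n s hn ih =>
    obtain ⟨π, h1, h2⟩ := ih
    refine ⟨Equiv.swap (π (P n)) (P' n) * π, Good.mul (Good.swap ((h1.mi _).2 (hP n)) (hP' n)
      ((h1.deg _).trans (hd n))) h1, ?_⟩
    intro i his
    rw [Equiv.Perm.mul_apply]
    by_cases hin : i = n
    · subst hin
      rw [Equiv.swap_apply_left]
    · have his' := Finset.mem_of_mem_insert_of_ne his hin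
      rw [Equiv.swap_apply_of_ne_of_ne, h2 i his']
      · intro hc
        exact hin (hi (π.injective hc))
      · rw [h2 i his']
        intro hc
        exact hin (hi' hc)

/-- action on data -/
noncomputable def act (π : Equiv.Perm k[X]) (m : Multiset (Multiset ℕ+ × k[X])) :
    Multiset (Multiset ℕ+ × k[X]) := m.map (fun x => (x.1, π x.2))

lemma act_act (π π' : Equiv.Perm k[X]) (m : Multiset (Multiset ℕ+ × k[X])) :
    act π (act π' m) = act (π * π') m := by
  rw [act, act, Multiset.map_map]; rfl

lemma act_one (m : Multiset (Multiset ℕ+ × k[X])) : act 1 m = m := by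
  rw [act]; exact Multiset.map_id m

lemma act_inj {π : Equiv.Perm k[X]} {m m' : Multiset (Multiset ℕ+ × k[X])} :
    act π m = act π m' ↔ m = m' := by
  constructor
  · intro h
    have := congrArg (act π⁻¹) h
    simpa [act_act, act_one] using this
  · rintro rfl; rfl

lemma shad_act {π : Equiv.Perm k[X]} (h : Good π) (m : Multiset (Multiset ℕ+ × k[X])) :
    shad (act π m) = shad m := by
  rw [act, shad, shad, Multiset.map_map]
  apply Multiset.map_congr rfl
  intro x _
  simp [h.deg]

/-- membership in the Segre class type -/
def InC (τ : Multiset (Multiset ℕ+ × ℕ)) (m : Multiset (Multiset ℕ+ × k[X])) : Prop :=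
  (∀ x ∈ m, MI x.2) ∧ (m.map Prod.snd).Nodup ∧ shad m = τ

lemma SegreClassType_eq (τ : Multiset (Multiset ℕ+ × ℕ)) :
    SegreClassType τ k = {m : Multiset (Multiset ℕ+ × k[X]) // InC τ m} := rfl

variable {τ ρ σ : Multiset (Multiset ℕ+ × ℕ)}

lemma InC.act {π : Equiv.Perm k[X]} (hπ : Good π) {m : Multiset (Multiset ℕ+ × k[X])}
    (h : InC τ m) : InC τ (act π m) := by
  refine ⟨?_, ?_, ?_⟩
  · intro x hx
    obtain ⟨y, hy, rfl⟩ := Multiset.mem_map.1 hx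
    exact (hπ.mi _).2 (h.1 y hy)
  · have : (SegreHall.act π m).map Prod.snd = (m.map Prod.snd).map π := by
      rw [SegreHall.act, Multiset.map_map, Multiset.map_map]; rfl
    rw [this]
    exact Multiset.Nodup.map π.injective h.2.1
  · rw [shad_act hπ]; exact h.2.2

lemma InC.isData [Finite k] (hτ : ∀ p ∈ τ, p.1 ≠ 0 ∧ 0 < p.2)
    {m : Multiset (Multiset ℕ+ × k[X])} (h : InC τ m) : IsData (moduleOfData k m) m :=
  moduleOfData_isData2 h.1 (shad_ne hτ h.2.2) h.2.1

/-- permuting a Segre class -/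
noncomputable def actE (τ : Multiset (Multiset ℕ+ × ℕ)) (π : Equiv.Perm k[X]) (hπ : Good π) :
    SegreClassType τ k ≃ SegreClassType τ k where
  toFun t := ⟨act π t.1, InC.act (τ := τ) hπ t.2⟩
  invFun t := ⟨act π⁻¹ t.1, InC.act (τ := τ) hπ.inv t.2⟩
  left_inv t := Subtype.ext (by simp [act_act, act_one])
  right_inv t := Subtype.ext (by simp [act_act, act_one])

lemma transitive [Finite k] (hτ : ∀ p ∈ τ, p.1 ≠ 0 ∧ 0 < p.2)
    {m m' : Multiset (Multiset ℕ+ × k[X])} (h : InC τ m) (h' : InC τ m') :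
    ∃ π : Equiv.Perm k[X], Good π ∧ act π m = m' := by
  obtain ⟨P, h1, h2⟩ := exists_enum h.2.2
  obtain ⟨P', h1', h2'⟩ := exists_enum h'.2.2
  have hd := h.isData hτ
  have hd' := h'.isData hτ
  have e1 := hd
  have e1' := hd'
  rw [h1] at hd
  rw [h1'] at hd'
  obtain ⟨a1, a2, -, -⟩ := hd.typed
  obtain ⟨b1, b2, -, -⟩ := hd'.typed
  obtain ⟨π, hπ, hh⟩ := exists_good P P' a1 b1 a2 b2 (fun i => (h2 i).trans (h2' i).symm) Finset.univ
  refine ⟨π, hπ, ?_⟩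
  rw [h1, h1', act, Multiset.map_map]
  apply Multiset.map_congr rfl
  intro i _
  simp [hh i (Finset.mem_univ i)]

lemma finite_natDegree [Finite k] (d : ℕ) : {p : k[X] | p.natDegree = d}.Finite := by
  have h : Finite (degreeLT k (d + 1)) := Finite.of_equiv _ (degreeLTEquiv k (d + 1)).symm.toEquiv
  refine Set.Finite.subset (s := (degreeLT k (d + 1) : Set k[X])) (Set.toFinite _) ?_
  intro p hp
  rw [SetLike.mem_coe, mem_degreeLT]
  refine lt_of_le_of_lt degree_le_natDegree ?_
  have hp' : p.natDegree = d := hp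
  rw [hp']
  exact_mod_cast Nat.lt_succ_self d

lemma finite_class [Finite k] (τ : Multiset (Multiset ℕ+ × ℕ)) : Finite (SegreClassType τ k) := by
  have h1 : (Set.pi Set.univ (fun i : Ix τ => {p : k[X] | p.natDegree = (en τ i).2})).Finite :=
    Set.Finite.pi' (fun i => finite_natDegree _) |>.subset (fun f hf i => hf i trivial)
  have h2 := h1.image (fun P => (Finset.univ : Finset (Ix τ)).val.map (fun i => ((en τ i).1, P i)))
  have h3 : {m : Multiset (Multiset ℕ+ × k[X]) | InC τ m}.Finite := by
    refine h2.subset ?_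
    intro m hm
    obtain ⟨P, a, b⟩ := exists_enum hm.2.2
    exact ⟨P, fun i _ => b i, a.symm⟩
  exact h3.to_subtype

/-- weighted count -/
noncomputable def W (k : Type) [Field k] (t : Multiset (Multiset ℕ+ × k[X]))
    (D : Multiset (Multiset ℕ+ × k[X]) → Multiset (Multiset ℕ+ × k[X]) → Prop) : ℕ :=
  Nat.card {U : Submodule k[X] (moduleOfData k t) //
    D (dataOf k U) (dataOf k (moduleOfData k t ⧸ U))}

lemma W_act [Finite k] (hτ : ∀ p ∈ τ, p.1 ≠ 0 ∧ 0 < p.2) {t : Multiset (Multiset ℕ+ × k[X])}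
    (ht : InC τ t) {π : Equiv.Perm k[X]} (hπ : Good π)
    (D : Multiset (Multiset ℕ+ × k[X]) → Multiset (Multiset ℕ+ × k[X]) → Prop) :
    W k (act π t) D = W k t (fun x y => D (act π x) (act π y)) := by
  have := Fintype.ofFinite k
  obtain ⟨P, h1, h2⟩ := exists_enum ht.2.2
  have hd := ht.isData hτ
  have hd' := (ht.act hπ).isData hτ
  have h1' : act π t = (Finset.univ : Finset (Ix τ)).val.map (fun i => ((en τ i).1, π (P i))) := by
    rw [h1, act, Multiset.map_map]; rfl
  obtain ⟨F, hF⟩ := count_data (Ix τ) (fun i => (en τ i).1) (fun i => (en τ i).2)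
    (fun a b => D (dat (fun i => π (P i)) a) (dat (fun i => π (P i)) b))
  have g1 := hF k P h2 (moduleOfData k t) (h1 ▸ hd) (fun x y => D (act π x) (act π y)) (by
    intro a b
    rw [act, act, dat_map, dat_map])
  have g2 := hF k (fun i => π (P i)) (fun i => (hπ.deg _).trans (h2 i)) (moduleOfData k (act π t))
    (h1' ▸ hd') D (fun a b => Iff.rfl)
  exact_mod_cast g2.trans g1.symm

lemma isData_inC [Finite k] {M : Type} [AddCommGroup M] [Module k[X] M]
    {m : Multiset (Multiset ℕ+ × k[X])} (h : IsData M m) : InC (shad m) m :=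
  ⟨h.mi, h.nodup, rfl⟩

end kt
end SegreHall

namespace SegreHall
section kt
variable {k : Type} [Field k]
variable {τ α : Multiset (Multiset ℕ+ × ℕ)}

lemma W_fiber [Finite k] [Fintype (SegreClassType α k)] (hτ : ∀ p ∈ τ, p.1 ≠ 0 ∧ 0 < p.2)
    (D : Multiset (Multiset ℕ+ × k[X]) → Multiset (Multiset ℕ+ × k[X]) → Prop)
    (pr : Multiset (Multiset ℕ+ × k[X]) → Multiset (Multiset ℕ+ × k[X]) →
      Multiset (Multiset ℕ+ × k[X]))
    (hpr : ∀ x y, D x y → InC (shad x) x → InC (shad y) y → InC α (pr x y))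
    {t : Multiset (Multiset ℕ+ × k[X])} (ht : InC τ t) :
    W k t D = ∑ z : SegreClassType α k, W k t (fun x y => D x y ∧ pr x y = z.1) := by
  have hfin := (ht.isData hτ).fin
  have hfin' : ∀ U : Submodule k[X] (moduleOfData k t), Finite (moduleOfData k t ⧸ U) :=
    fun U => Finite.of_surjective _ (Submodule.mkQ_surjective U)
  let f : {U : Submodule k[X] (moduleOfData k t) //
    D (dataOf k U) (dataOf k (moduleOfData k t ⧸ U))} → SegreClassType α k := fun U =>
      ⟨pr (dataOf k U.1) (dataOf k (moduleOfData k t ⧸ U.1)),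
        hpr _ _ U.2 (isData_inC (isData_dataOf _)) (isData_inC (isData_dataOf _))⟩
  rw [W, ← Nat.card_congr (Equiv.sigmaFiberEquiv f), Nat.card_sigma]
  apply Finset.sum_congr rfl
  intro z _
  refine Nat.card_congr ?_
  exact
    { toFun := fun U => ⟨U.1.1, U.1.2, congrArg Subtype.val U.2⟩
      invFun := fun U => ⟨⟨U.1, U.2.1⟩, Subtype.ext U.2.2⟩
      left_inv := fun _ => rfl
      right_inv := fun _ => rfl }

lemma card_sig [Finite k] [Fintype (SegreClassType τ k)] (hτ : ∀ p ∈ τ, p.1 ≠ 0 ∧ 0 < p.2)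
    (D : Multiset (Multiset ℕ+ × k[X]) → Multiset (Multiset ℕ+ × k[X]) → Prop) :
    Nat.card (Σ t : SegreClassType τ k, {U : Submodule k[X] (moduleOfData k t.1) //
      D (dataOf k U) (dataOf k (moduleOfData k t.1 ⧸ U))}) = ∑ t : SegreClassType τ k, W k t.1 D := by
  have hfin : ∀ t : SegreClassType τ k, Finite (moduleOfData k t.1) := fun t =>
    (InC.isData (τ := τ) hτ t.2).fin
  rw [Nat.card_sigma]
  rfl

lemma double_count [Finite k] (hτ : ∀ p ∈ τ, p.1 ≠ 0 ∧ 0 < p.2) (hα : ∀ p ∈ α, p.1 ≠ 0 ∧ 0 < p.2)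
    (D : Multiset (Multiset ℕ+ × k[X]) → Multiset (Multiset ℕ+ × k[X]) → Prop)
    (pr : Multiset (Multiset ℕ+ × k[X]) → Multiset (Multiset ℕ+ × k[X]) →
      Multiset (Multiset ℕ+ × k[X]))
    (hpr : ∀ x y, D x y → InC (shad x) x → InC (shad y) y → InC α (pr x y))
    (hD : ∀ π : Equiv.Perm k[X], Good π → ∀ x y, D (act π x) (act π y) ↔ D x y)
    (hpe : ∀ π : Equiv.Perm k[X], Good π → ∀ x y, pr (act π x) (act π y) = act π (pr x y))
    (F : ℤ) (hF : ∀ t, InC τ t → (W k t D : ℤ) = F) {z0 : Multiset (Multiset ℕ+ × k[X])}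
    (hz : InC α z0) :
    (Nat.card (SegreClassType τ k) : ℤ) * F = (Nat.card (SegreClassType α k) : ℤ) *
      (Nat.card (Σ t : SegreClassType τ k, {U : Submodule k[X] (moduleOfData k t.1) //
      D (dataOf k U) (dataOf k (moduleOfData k t.1 ⧸ U)) ∧
        pr (dataOf k U) (dataOf k (moduleOfData k t.1 ⧸ U)) = z0}) : ℤ) := by
  have := finite_class (k := k) τ
  have := finite_class (k := k) α
  have := Fintype.ofFinite (SegreClassType τ k)
  have := Fintype.ofFinite (SegreClassType α k)
  have e0 := card_sig (k := k) hτ (fun x y => D x y ∧ pr x y = z0)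
  rw [e0]
  have e1 : ∀ z : SegreClassType α k, ∑ t : SegreClassType τ k, W k t.1 (fun x y => D x y ∧ pr x y = z.1)
      = ∑ t : SegreClassType τ k, W k t.1 (fun x y => D x y ∧ pr x y = z0) := by
    intro z
    obtain ⟨π, h1, h2⟩ := transitive hα hz z.2
    rw [← Equiv.sum_comp (actE τ π h1)]
    apply Finset.sum_congr rfl
    intro t _
    change W k (act π t.1) _ = _
    rw [W_act hτ t.2 h1]
    congr 1
    funext x y
    rw [hD π h1, hpe π h1, ← h2, act_inj]
  have e2 : ∑ t : SegreClassType τ k, W k t.1 D =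
      Nat.card (SegreClassType α k) *
        ∑ t : SegreClassType τ k, W k t.1 (fun x y => D x y ∧ pr x y = z0) := by
    rw [Finset.sum_congr rfl (fun t _ => W_fiber hτ D pr hpr t.2), Finset.sum_comm,
      Finset.sum_congr rfl (fun z _ => e1 z), Finset.sum_const, smul_eq_mul, Finset.card_univ,
      Nat.card_eq_fintype_card]
  have e3 : ((∑ t : SegreClassType τ k, W k t.1 D : ℕ) : ℤ) = (Nat.card (SegreClassType τ k) : ℤ) * F := by
    push_cast
    rw [Finset.sum_congr rfl (fun t _ => hF t.1 t.2), Finset.sum_const, nsmul_eq_mul,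
      Finset.card_univ, Nat.card_eq_fintype_card]
  rw [← e3, e2]
  push_cast
  rfl

lemma double_dvd [Finite k] (hτ : ∀ p ∈ τ, p.1 ≠ 0 ∧ 0 < p.2) (hα : ∀ p ∈ α, p.1 ≠ 0 ∧ 0 < p.2)
    (D : Multiset (Multiset ℕ+ × k[X]) → Multiset (Multiset ℕ+ × k[X]) → Prop)
    (pr : Multiset (Multiset ℕ+ × k[X]) → Multiset (Multiset ℕ+ × k[X]) →
      Multiset (Multiset ℕ+ × k[X]))
    (hpr : ∀ x y, D x y → InC (shad x) x → InC (shad y) y → InC α (pr x y))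
    (hD : ∀ π : Equiv.Perm k[X], Good π → ∀ x y, D (act π x) (act π y) ↔ D x y)
    (hpe : ∀ π : Equiv.Perm k[X], Good π → ∀ x y, pr (act π x) (act π y) = act π (pr x y))
    (F : ℤ) (hF : ∀ t, InC τ t → (W k t D : ℤ) = F) :
    ∃ c : ℤ, (Nat.card (SegreClassType τ k) : ℤ) * F = (Nat.card (SegreClassType α k) : ℤ) * c := by
  by_cases h : Nonempty (SegreClassType α k)
  · obtain ⟨z⟩ := h
    exact ⟨_, double_count hτ hα D pr hpr hD hpe F hF (z0 := z.1) z.2⟩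
  · rw [not_nonempty_iff] at h
    refine ⟨0, ?_⟩
    rw [mul_zero]
    by_cases h' : Nonempty (SegreClassType τ k)
    · obtain ⟨t⟩ := h'
      have := Fintype.ofFinite (SegreClassType α k)
      have h1 := W_fiber hτ D pr hpr t.2
      rw [Finset.univ_eq_empty, Finset.sum_empty] at h1
      rw [← hF t.1 t.2, h1]
      simp
    · rw [not_nonempty_iff] at h'
      simp

end kt

/-- divisibility from divisibility of values at primes -/
lemma poly_dvd (n f : ℚ[X])
    (h : ∀ p : ℕ, p.Prime → ∃ c : ℤ, f.eval (p : ℚ) = n.eval (p : ℚ) * c) : ∃ G, n * G = f := by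
  by_cases hn : n = 0
  · subst hn
    refine ⟨0, ?_⟩
    rw [zero_mul]
    symm
    apply Polynomial.eq_zero_of_infinite_isRoot
    refine Set.Infinite.mono ?_ (Nat.infinite_setOfPred_prime.image (f := fun p : ℕ => (p : ℚ))
      (Nat.cast_injective.injOn))
    rintro _ ⟨p, hp, rfl⟩
    obtain ⟨c, hc⟩ := h p hp
    simpa using hc
  · refine ⟨f / n, ?_⟩
    have hdm := EuclideanDomain.div_add_mod f n
    suffices hr : f % n = 0 by rw [hr, add_zero] at hdm; exact hdm
    obtain ⟨b, hb0, g, hg⟩ : ∃ b : ℤ, b ≠ 0 ∧ ∃ g : ℤ[X],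
        g.map (algebraMap ℤ ℚ) = b • (f / n) := by
      obtain ⟨b, hb0, hb⟩ := IsLocalization.integerNormalization_spec (nonZeroDivisors ℤ) (f / n)
      exact ⟨b, nonZeroDivisors.ne_zero hb0, _, hb⟩
    have ht : Filter.Tendsto (fun x : ℚ => (f % n).eval x / n.eval x) Filter.atTop (nhds 0) :=
      Polynomial.div_tendsto_zero_of_degree_lt _ _ (EuclideanDomain.mod_lt f hn)
    have ht' : Filter.Tendsto (fun p : ℕ => (f % n).eval (p : ℚ) / n.eval (p : ℚ))
        Filter.atTop (nhds 0) :=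
      ht.comp tendsto_natCast_atTop_atTop
    have hbq : (b : ℚ) ≠ 0 := by exact_mod_cast hb0
    have hpos : (0 : ℚ) < 1 / |(b : ℚ)| := by positivity
    have hev := ht'.eventually ((nhds_basis_abs_sub_lt (0 : ℚ)).mem_of_mem hpos)
    obtain ⟨N, hN⟩ := Filter.eventually_atTop.1 hev
    apply Polynomial.eq_zero_of_infinite_isRoot
    refine Set.Infinite.mono ?_ ((Nat.infinite_setOfPred_prime.diff (Set.finite_Iio N)).image
      (f := fun p : ℕ => (p : ℚ)) (Nat.cast_injective.injOn))
    rintro _ ⟨p, ⟨hp, hpN⟩, rfl⟩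
    have hpN' : N ≤ p := not_lt.1 hpN
    obtain ⟨c, hc⟩ := h p hp
    have h1 : n.eval (p : ℚ) * (f / n).eval (p : ℚ) + (f % n).eval (p : ℚ) = f.eval (p : ℚ) := by
      rw [← eval_mul, ← eval_add, hdm]
    have h2 : ((g.eval (p : ℤ) : ℤ) : ℚ) = b * (f / n).eval (p : ℚ) := by
      have := congrArg (Polynomial.eval (p : ℚ)) hg
      rw [eval_smul, zsmul_eq_mul] at this
      rw [← this]
      have h3 := Polynomial.eval_map_algebraMap (B := ℚ) g ((p : ℕ) : ℚ)
      rw [h3]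
      have h4 := Polynomial.aeval_algebraMap_apply ℚ (p : ℤ) g
      simpa using h4.symm
    change (f % n).eval (p : ℚ) = 0
    by_cases hn0 : n.eval (p : ℚ) = 0
    · rw [hn0] at h1 hc
      linarith
    · have h5 : (f % n).eval (p : ℚ) / n.eval (p : ℚ) = c - (f / n).eval (p : ℚ) := by
        rw [div_eq_iff hn0]
        linarith
      have h6 := hN p hpN'
      simp only [sub_zero, Set.mem_setOf_eq] at h6
      have h7 : |(b : ℚ) * ((f % n).eval (p : ℚ) / n.eval (p : ℚ))| < 1 := by
        rw [abs_mul]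
        rwa [lt_div_iff₀ (abs_pos.2 hbq), mul_comm] at h6
      have h8 : (b : ℚ) * ((f % n).eval (p : ℚ) / n.eval (p : ℚ)) = ((b * c - g.eval (p : ℤ) : ℤ) : ℚ) := by
        rw [h5]
        push_cast
        rw [h2]
        ring
      rw [h8] at h7
      have h9 : (b * c - g.eval (p : ℤ) : ℤ) = 0 := by
        rw [← Int.abs_lt_one_iff]
        exact_mod_cast h7
      rw [h9, Int.cast_zero] at h8
      have h10 := (mul_eq_zero.1 h8).resolve_left hbq
      exact (div_eq_zero_iff.1 h10).resolve_right hn0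

end SegreHall

namespace SegreHall

/-- the counting predicate -/
def DD {k : Type} [Field k] (ρ σ : Multiset (Multiset ℕ+ × ℕ))
    (x y : Multiset (Multiset ℕ+ × k[X])) : Prop := shad x = σ ∧ shad y = ρ

lemma DD_act {k : Type} [Field k] (ρ σ : Multiset (Multiset ℕ+ × ℕ)) :
    ∀ π : Equiv.Perm k[X], Good π → ∀ x y, DD ρ σ (act π x) (act π y) ↔ DD ρ σ x y := by
  intro π hπ x y
  rw [DD, DD, shad_act hπ, shad_act hπ]

theorem exists_F (ρ σ τ : Multiset (Multiset ℕ+ × ℕ)) : ∃ F : ℤ[X],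
    ∀ (k : Type) [Field k] [Fintype k] (T : Type) [AddCommGroup T] [Module k[X] T]
      (m : Multiset (Multiset ℕ+ × k[X])), shad m = τ → IsData T m →
      (Nat.card {U : Submodule k[X] T // DD ρ σ (dataOf k U) (dataOf k (T ⧸ U))} : ℤ) =
        F.eval (Fintype.card k : ℤ) := by
  obtain ⟨F, hF⟩ := count_data (Ix τ) (fun i => (en τ i).1) (fun i => (en τ i).2)
    (fun a b => dat (fun i => (en τ i).2) a = σ ∧ dat (fun i => (en τ i).2) b = ρ)
  refine ⟨F, ?_⟩
  intro k _ _ T _ _ m hm hT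
  obtain ⟨P, h1, h2⟩ := exists_enum hm
  refine hF k P h2 T (h1 ▸ hT) (DD ρ σ) ?_
  intro a b
  have e : ∀ a, shad (dat P a) = dat (fun i => (en τ i).2) a := by
    intro a
    rw [shad, dat_map]
    congr 1
    funext i
    exact h2 i
  rw [DD, e, e]

end SegreHall

open SegreHall

/-- **Hall polynomials for Segre classes of `k[t]`-modules** (Theorem 6 of the paper).
Given Segre symbols `ρ, σ, τ` there is `F_{ρσ}^τ ∈ ℤ[T]` with, for every finite field
`k` with `q` elements:
(i)  `F_{ρσ}^τ(q) = Σ_{R ∈ S(ρ,k), S ∈ S(σ,k)} F_{RS}^T` for every `T ∈ S(τ,k)`;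
(ii) `n_τ(q)F_{ρσ}^τ(q) = n_ρ(q) Σ_{S ∈ S(σ,k), T ∈ S(τ,k)} F_{RS}^T` for every `R ∈ S(ρ,k)`;
(iii) `n_τ(q)F_{ρσ}^τ(q) = n_σ(q) Σ_{R ∈ S(ρ,k), T ∈ S(τ,k)} F_{RS}^T` for every `S ∈ S(σ,k)`;
where `n_α(q) = |S(α,k)|`.  In particular `(n_τ/n_ρ)F_{ρσ}^τ` and `(n_τ/n_σ)F_{ρσ}^τ`
are polynomials with rational coefficients. -/
theorem segre_hall_polynomials (ρ σ τ : Multiset (Multiset ℕ+ × ℕ))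
    (hρ : ∀ p ∈ ρ, p.1 ≠ 0 ∧ 0 < p.2) (hσ : ∀ p ∈ σ, p.1 ≠ 0 ∧ 0 < p.2)
    (hτ : ∀ p ∈ τ, p.1 ≠ 0 ∧ 0 < p.2) :
    ∃ F : Polynomial ℤ,
      (∀ (k : Type) [Field k] [Fintype k],
        (∀ (T : Type) [AddCommGroup T] [Module (Polynomial k) T], InSegreClass τ k T →
          (Nat.card {U : Submodule (Polynomial k) T //
              InSegreClass σ k U ∧ InSegreClass ρ k (T ⧸ U)} : ℤ)
            = F.eval ((Fintype.card k : ℤ))) ∧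
        (∀ (R : Type) [AddCommGroup R] [Module (Polynomial k) R], InSegreClass ρ k R →
          (Nat.card (SegreClassType τ k) : ℤ) * F.eval ((Fintype.card k : ℤ))
            = (Nat.card (SegreClassType ρ k) : ℤ) *
              (Nat.card (Σ t : SegreClassType τ k,
                {U : Submodule (Polynomial k) (moduleOfData k t.1) //
                  InSegreClass σ k U ∧
                  Nonempty ((moduleOfData k t.1 ⧸ U) ≃ₗ[Polynomial k] R)}) : ℤ)) ∧
        (∀ (S : Type) [AddCommGroup S] [Module (Polynomial k) S], InSegreClass σ k S →
          (Nat.card (SegreClassType τ k) : ℤ) * F.eval ((Fintype.card k : ℤ))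
            = (Nat.card (SegreClassType σ k) : ℤ) *
              (Nat.card (Σ t : SegreClassType τ k,
                {U : Submodule (Polynomial k) (moduleOfData k t.1) //
                  Nonempty (U ≃ₗ[Polynomial k] S) ∧
                  InSegreClass ρ k (moduleOfData k t.1 ⧸ U)}) : ℤ))) ∧
      (∀ nρ nσ' nτ : Polynomial ℚ,
        (∀ (k : Type) [Field k] [Fintype k],
            (Nat.card (SegreClassType ρ k) : ℚ) = nρ.eval ((Fintype.card k : ℚ)) ∧
            (Nat.card (SegreClassType σ k) : ℚ) = nσ'.eval ((Fintype.card k : ℚ)) ∧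
            (Nat.card (SegreClassType τ k) : ℚ) = nτ.eval ((Fintype.card k : ℚ))) →
          (∃ G : Polynomial ℚ, nρ * G = nτ * F.map (Int.castRingHom ℚ)) ∧
          (∃ H : Polynomial ℚ, nσ' * H = nτ * F.map (Int.castRingHom ℚ))) := by
  obtain ⟨F, hF⟩ := exists_F ρ σ τ
  have hW : ∀ (k : Type) [Field k] [Fintype k] (t : Multiset (Multiset ℕ+ × k[X])), InC τ t →
      (W k t (DD ρ σ) : ℤ) = F.eval (Fintype.card k : ℤ) := by
    intro k _ _ t ht
    exact hF k (moduleOfData k t) t ht.2.2 (ht.isData hτ)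
  have hpr1 : ∀ (k : Type) [Field k] (x y : Multiset (Multiset ℕ+ × k[X])), DD ρ σ x y →
      InC (shad x) x → InC (shad y) y → InC ρ y := by
    intro k _ x y h _ h2
    have h3 : shad y = ρ := h.2
    rwa [h3] at h2
  have hpr2 : ∀ (k : Type) [Field k] (x y : Multiset (Multiset ℕ+ × k[X])), DD ρ σ x y →
      InC (shad x) x → InC (shad y) y → InC σ x := by
    intro k _ x y h h2 _
    have h3 : shad x = σ := h.1
    rwa [h3] at h2
  have hq : ∀ {k : Type} [Field k] {T : Type} [AddCommGroup T] [Module k[X] T] [Finite T]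
      (U : Submodule k[X] T), Finite (T ⧸ U) :=
    fun U => Finite.of_surjective _ (Submodule.mkQ_surjective U)
  refine ⟨F, ?_, ?_⟩
  · intro k _ _
    refine ⟨?_, ?_, ?_⟩
    · intro T _ _ hT
      obtain ⟨m, h1, h2⟩ := (inSegre_iff hτ).1 hT
      rw [← hF k T m h1 h2]
      congr 1
      refine Nat.card_congr (Equiv.subtypeEquivRight ?_)
      intro U
      have := h2.fin
      have := hq U
      rw [inSegre_iff_shad hσ, inSegre_iff_shad hρ]
      rfl
    · intro R _ _ hR
      obtain ⟨m, h1, h2⟩ := (inSegre_iff hρ).1 hR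
      have hm : InC ρ m := ⟨h2.mi, h2.nodup, h1⟩
      rw [double_count hτ hρ (DD ρ σ) (fun _ y => y) (hpr1 k) (DD_act ρ σ) (fun _ _ _ _ => rfl)
        _ (hW k) hm]
      congr 2
      refine Nat.card_congr (Equiv.sigmaCongrRight fun t => Equiv.subtypeEquivRight ?_)
      intro U
      have := (InC.isData (τ := τ) hτ t.2).fin
      have := hq U
      have := h2.fin
      rw [inSegre_iff_shad hσ, iso_iff, dataOf_eq h2]
      constructor
      · rintro ⟨a, b⟩
        exact ⟨a.1, b⟩
      · rintro ⟨a, b⟩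
        exact ⟨⟨a, by rw [b]; exact h1⟩, b⟩
    · intro S _ _ hS
      obtain ⟨m, h1, h2⟩ := (inSegre_iff hσ).1 hS
      have hm : InC σ m := ⟨h2.mi, h2.nodup, h1⟩
      rw [double_count hτ hσ (DD ρ σ) (fun x _ => x) (hpr2 k) (DD_act ρ σ) (fun _ _ _ _ => rfl)
        _ (hW k) hm]
      congr 2
      refine Nat.card_congr (Equiv.sigmaCongrRight fun t => Equiv.subtypeEquivRight ?_)
      intro U
      have := (InC.isData (τ := τ) hτ t.2).fin
      have := hq U
      have := h2.fin
      rw [inSegre_iff_shad hρ, iso_iff, dataOf_eq h2]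
      constructor
      · rintro ⟨a, b⟩
        exact ⟨b, a.2⟩
      · rintro ⟨a, b⟩
        exact ⟨⟨by rw [a]; exact h1, b⟩, a⟩
  · intro nρ nσ' nτ hn
    have hFe : ∀ p : ℕ, (F.map (Int.castRingHom ℚ)).eval (p : ℚ) = ((F.eval (p : ℤ) : ℤ) : ℚ) := by
      intro p
      have h := Polynomial.eval_intCast_map (Int.castRingHom ℚ) F (p : ℤ)
      simpa using h
    constructor
    · apply poly_dvd
      intro p hp
      have := Fact.mk hp
      obtain ⟨h1, h2, h3⟩ := hn (ZMod p)
      obtain ⟨c, hc⟩ := double_dvd hτ hρ (DD ρ σ) (fun _ y => y) (hpr1 (ZMod p)) (DD_act ρ σ)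
        (fun _ _ _ _ => rfl) _ (hW (ZMod p))
      rw [ZMod.card] at h1 h2 h3 hc
      refine ⟨c, ?_⟩
      rw [eval_mul, hFe, ← h1, ← h3]
      exact_mod_cast hc
    · apply poly_dvd
      intro p hp
      have := Fact.mk hp
      obtain ⟨h1, h2, h3⟩ := hn (ZMod p)
      obtain ⟨c, hc⟩ := double_dvd hτ hσ (DD ρ σ) (fun x _ => x) (hpr2 (ZMod p)) (DD_act ρ σ)
        (fun _ _ _ _ => rfl) _ (hW (ZMod p))
      rw [ZMod.card] at h1 h2 h3 hc
      refine ⟨c, ?_⟩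
      rw [eval_mul, hFe, ← h2, ← h3]
      exact_mod_cast hc
end

section
/- Let (A,B) be an orthogonal exceptional pair of kQ-modules and set d := dim_k Ext^1(A,B). If Q is a Dynkin quiver, then d ≤ 1; if Q is an extended Dynkin quiver, then d ≤ 2. Moreover, if Q is extended Dynkin and d = 2, then dim A + dim B = δ (the dimension vector of A ⊕ B is the minimal positive imaginary root) and the defect ∂(A) = 1. -/
open Polynomial

/-- A finite quiver, given by a finite set of vertices, a finite set of arrows,
and source/target maps. -/
structure QuiverData where
  V : Type
  A : Type
  [fintV : Fintype V]
  [decV : DecidableEq V]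
  [fintA : Fintype A]
  s : A → V
  t : A → V

attribute [instance] QuiverData.fintV QuiverData.decV QuiverData.fintA

/-- A representation of a quiver over a field `k`:  a finite dimensional vector
space at each vertex together with a linear map for each arrow.  This is the same
thing as a `kQ`-module (finite dimensionality is imposed separately via `FinDim`). -/
structure Repn (k : Type) [Field k] (Q : QuiverData) where
  space : Q.V → Type
  [addcg : ∀ v, AddCommGroup (space v)]
  [mod : ∀ v, Module k (space v)]
  map : ∀ a : Q.A, space (Q.s a) →ₗ[k] space (Q.t a)

attribute [instance] Repn.addcg Repn.mod

namespace Repn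

variable {k : Type} [Field k] {Q : QuiverData}

/-- An isomorphism of representations. -/
structure Iso (M N : Repn k Q) where
  e : ∀ v, M.space v ≃ₗ[k] N.space v
  comm : ∀ (a : Q.A) (x : M.space (Q.s a)), e (Q.t a) (M.map a x) = N.map a (e (Q.s a) x)

/-- Direct sum of two representations. -/
def dsum (M N : Repn k Q) : Repn k Q where
  space v := M.space v × N.space v
  map a := (M.map a).prodMap (N.map a)

/-- Direct sum of a family of representations. -/
def dsumFam {ι : Type} (X : ι → Repn k Q) : Repn k Q where
  space v := ∀ i, (X i).space v
  map a := LinearMap.pi fun i => ((X i).map a).comp (LinearMap.proj i)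

/-- The zero representation(s). -/
def IsZero (M : Repn k Q) : Prop := ∀ (v : Q.V) (x : M.space v), x = 0

/-- Pointwise finite dimensionality, i.e. `M` is a finite `kQ`-module. -/
def FinDim (M : Repn k Q) : Prop := ∀ v, FiniteDimensional k (M.space v)

/-- Indecomposability. -/
def Indec (M : Repn k Q) : Prop :=
  ¬ M.IsZero ∧ ∀ Y Z : Repn k Q, Nonempty (Iso M (Y.dsum Z)) → Y.IsZero ∨ Z.IsZero

/-- The dimension vector. -/
noncomputable def dimv (M : Repn k Q) : Q.V → ℕ := fun v => Module.finrank k (M.space v)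

end Repn

/-- A subrepresentation of `X`, i.e. a `kQ`-submodule. -/
structure Subrep {k : Type} [Field k] {Q : QuiverData} (X : Repn k Q) where
  sub : ∀ v, Submodule k (X.space v)
  stable : ∀ a : Q.A, (sub (Q.s a)).map (X.map a) ≤ sub (Q.t a)

namespace Subrep

variable {k : Type} [Field k] {Q : QuiverData} {X : Repn k Q}

/-- A subrepresentation as a representation. -/
def repn (U : Subrep X) : Repn k Q where
  space v := U.sub v
  map a := (X.map a).restrict fun _ hx => U.stable a (Submodule.mem_map_of_mem hx)

/-- The quotient representation `X/U`. -/
def quot (U : Subrep X) : Repn k Q where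
  space v := X.space v ⧸ U.sub v
  map a := Submodule.mapQ (U.sub (Q.s a)) (U.sub (Q.t a)) (X.map a)
    (Submodule.map_le_iff_le_comap.mp (U.stable a))

end Subrep

/-- The Hall number `F_{MN}^X`: the number of subrepresentations `U ≤ X` with
`U ≅ N` and `X/U ≅ M`. -/
noncomputable def hallNum {k : Type} [Field k] {Q : QuiverData} (M N X : Repn k Q) : ℕ :=
  Nat.card {U : Subrep X // Nonempty (Repn.Iso U.repn N) ∧ Nonempty (Repn.Iso U.quot M)}

/-- The number of automorphisms of a representation. -/
noncomputable def autCard {k : Type} [Field k] {Q : QuiverData} (M : Repn k Q) : ℕ :=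
  Nat.card (Repn.Iso M M)

/-- The Euler form of the quiver `Q`. -/
def eulerZ (Q : QuiverData) (d e : Q.V → ℤ) : ℤ :=
  (∑ v, d v * e v) - ∑ a, d (Q.s a) * e (Q.t a)

/-- The Tits quadratic form of `Q`. -/
def titsZ (Q : QuiverData) (d : Q.V → ℤ) : ℤ := eulerZ Q d d

/-- Coercion of a dimension vector to an integral vector. -/
def natc {Q : QuiverData} (d : Q.V → ℕ) : Q.V → ℤ := fun v => (d v : ℤ)

/-- Connectedness of the underlying graph of `Q`. -/
def QuiverData.Connected (Q : QuiverData) : Prop :=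
  ∀ u v : Q.V, Relation.ReflTransGen
    (fun x y => ∃ a, (Q.s a = x ∧ Q.t a = y) ∨ (Q.s a = y ∧ Q.t a = x)) u v

/-- `Q` is a Dynkin quiver iff it is connected and its Tits form is positive definite. -/
def IsDynkin (Q : QuiverData) : Prop :=
  Q.Connected ∧ ∀ d : Q.V → ℤ, d ≠ 0 → 0 < titsZ Q d

/-- `Q` is an extended Dynkin (affine) quiver iff it is connected and its Tits form is
positive semidefinite but not definite. -/
def IsAffine (Q : QuiverData) : Prop :=
  Q.Connected ∧ (∀ d : Q.V → ℤ, 0 ≤ titsZ Q d) ∧ ∃ d : Q.V → ℤ, d ≠ 0 ∧ titsZ Q d = 0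

/-- `δ` is the minimal positive imaginary root of the affine quiver `Q`. -/
def IsMinImagRoot (Q : QuiverData) (δ : Q.V → ℕ) : Prop :=
  δ ≠ 0 ∧ titsZ Q (natc δ) = 0 ∧
    ∀ d : Q.V → ℕ, d ≠ 0 → titsZ Q (natc d) = 0 → ∀ v, δ v ≤ d v

/-- `Q` is an oriented cycle iff every vertex has exactly one incoming and one
outgoing arrow (`Q` being connected). -/
def IsOrientedCycle (Q : QuiverData) : Prop :=
  ∀ v : Q.V, Nat.card {a : Q.A // Q.s a = v} = 1 ∧ Nat.card {a : Q.A // Q.t a = v} = 1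

/-- The standard map whose kernel is `Hom(M,N)` and whose cokernel is `Ext¹(M,N)`. -/
noncomputable def extMap {k : Type} [Field k] {Q : QuiverData} (M N : Repn k Q) :
    (∀ v, M.space v →ₗ[k] N.space v) →ₗ[k] (∀ a : Q.A, M.space (Q.s a) →ₗ[k] N.space (Q.t a)) :=
  LinearMap.pi fun a =>
    ((LinearMap.llcomp k (M.space (Q.s a)) (N.space (Q.s a)) (N.space (Q.t a)) (N.map a)).comp
        (LinearMap.proj (Q.s a)))
      - ((LinearMap.lcomp k (N.space (Q.t a)) (M.map a)).comp (LinearMap.proj (Q.t a)))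

/-- `dim_k Hom(M,N)`. -/
noncomputable def homDim {k : Type} [Field k] {Q : QuiverData} (M N : Repn k Q) : ℕ :=
  Module.finrank k (LinearMap.ker (extMap M N))

/-- `dim_k Ext¹(M,N)`. -/
noncomputable def extDim {k : Type} [Field k] {Q : QuiverData} (M N : Repn k Q) : ℕ :=
  Module.finrank k
    ((∀ a : Q.A, M.space (Q.s a) →ₗ[k] N.space (Q.t a)) ⧸ LinearMap.range (extMap M N))

/-- A representation is exceptional if `End(X) ≅ k` and `Ext¹(X,X) = 0`. -/
def IsExceptional {k : Type} [Field k] {Q : QuiverData} (X : Repn k Q) : Prop :=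
  homDim X X = 1 ∧ extDim X X = 0

/-- `(A,B)` is an orthogonal exceptional pair:  `A`, `B` are exceptional and
`Hom(A,B) = Hom(B,A) = Ext¹(B,A) = 0`. -/
def OrthExcPair {k : Type} [Field k] {Q : QuiverData} (A B : Repn k Q) : Prop :=
  IsExceptional A ∧ IsExceptional B ∧ homDim A B = 0 ∧ homDim B A = 0 ∧ extDim B A = 0

theorem eulerZ_add_left (Q : QuiverData) (x y z : Q.V → ℤ) :
    eulerZ Q (x + y) z = eulerZ Q x z + eulerZ Q y z := by
  simp only [eulerZ, Pi.add_apply, add_mul, Finset.sum_add_distrib]; ring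

theorem eulerZ_add_right (Q : QuiverData) (x y z : Q.V → ℤ) :
    eulerZ Q z (x + y) = eulerZ Q z x + eulerZ Q z y := by
  simp only [eulerZ, Pi.add_apply, mul_add, Finset.sum_add_distrib]; ring

theorem eulerZ_smul_left (Q : QuiverData) (m : ℤ) (x z : Q.V → ℤ) :
    eulerZ Q (m • x) z = m * eulerZ Q x z := by
  simp only [eulerZ, Pi.smul_apply, smul_eq_mul, mul_assoc, ← Finset.mul_sum]; ring

theorem eulerZ_smul_right (Q : QuiverData) (m : ℤ) (x z : Q.V → ℤ) :
    eulerZ Q z (m • x) = m * eulerZ Q z x := by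
  simp only [eulerZ, Pi.smul_apply, smul_eq_mul, mul_left_comm _ m, ← Finset.mul_sum]; ring

theorem natc_add {Q : QuiverData} (x y : Q.V → ℕ) : natc (x + y) = natc x + natc y := by
  funext v; simp [natc]

/-- The Euler form computes `dim Hom - dim Ext¹`. -/
theorem homDim_sub_extDim {k : Type} [Field k] {Q : QuiverData} (M N : Repn k Q)
    (hM : M.FinDim) (hN : N.FinDim) :
    (homDim M N : ℤ) - extDim M N = eulerZ Q (natc M.dimv) (natc N.dimv) := by
  have := hM
  have := hN
  unfold Repn.FinDim at *
  have h1 := LinearMap.finrank_range_add_finrank_ker (extMap M N)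
  have h2 := Submodule.finrank_quotient_add_finrank (LinearMap.range (extMap M N))
  rw [Module.finrank_pi_fintype] at h1 h2
  simp only [Module.finrank_linearMap] at h1 h2
  unfold homDim extDim eulerZ natc Repn.dimv
  zify at h1 h2
  linarith

/-- Every nonnegative vector on which the Tits form vanishes is a multiple of `δ`. -/
theorem exists_mul_of_tits_zero (Q : QuiverData) (δ : Q.V → ℕ)
    (hpos : ∀ d : Q.V → ℤ, 0 ≤ titsZ Q d) (hδ : IsMinImagRoot Q δ) (n : ℕ) :
    ∀ d : Q.V → ℕ, ∑ v, d v = n → titsZ Q (natc d) = 0 → ∃ m : ℕ, d = m • δ := by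
  induction n using Nat.strong_induction_on with
  | _ n ih =>
    intro d hn hd
    by_cases h0 : d = 0
    · exact ⟨0, by simp [h0]⟩
    · have hle := hδ.2.2 d h0 hd
      have hsplit : d = (d - δ) + δ := by
        funext v; simp [Nat.sub_add_cancel (hle v)]
      have hsplitZ : natc d = natc (d - δ) + natc δ := by rw [← natc_add, ← hsplit]
      have hq : titsZ Q (natc (d - δ)) = 0 := by
        have e1 : natc (d - δ) = natc d + (-1 : ℤ) • natc δ := by
          rw [hsplitZ]; funext v; simp
        have p1 := hpos (natc (d - δ))
        have p2 := hpos (natc d + natc δ)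
        have q1 := hδ.2.1
        rw [e1] at p1 ⊢
        simp only [titsZ, eulerZ_add_left, eulerZ_add_right, eulerZ_smul_left,
          eulerZ_smul_right] at *
        linarith
      have hδs : 0 < ∑ v, δ v := by
        obtain ⟨v, hv⟩ := Function.ne_iff.mp hδ.1
        exact Finset.sum_pos' (fun _ _ => Nat.zero_le _)
          ⟨v, Finset.mem_univ v, Nat.pos_of_ne_zero hv⟩
      have hs : ∑ v, d v = ∑ v, (d - δ) v + ∑ v, δ v := by
        rw [← Finset.sum_add_distrib]
        exact Finset.sum_congr rfl fun v _ => congrFun hsplit v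
      obtain ⟨m, hm⟩ := ih (∑ v, (d - δ) v) (by omega) (d - δ) rfl hq
      exact ⟨m + 1, by rw [hsplit, hm, add_smul, one_smul]⟩

/-- **Lemma 2 of the paper.**  Let `(A,B)` be an orthogonal exceptional pair of
`kQ`-modules and `d := dim Ext¹(A,B)`.  If `Q` is Dynkin then `d ≤ 1`; if `Q` is
extended Dynkin then `d ≤ 2`, and if moreover `d = 2` then `dim A + dim B = δ` and
`∂(A) = 1`. -/
theorem ext_dim_of_orth_exc_pair (Q : QuiverData) (k : Type) [Field k]
    (A B : Repn k Q) (hA : A.FinDim) (hB : B.FinDim) (hpair : OrthExcPair A B) :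
    (IsDynkin Q → extDim A B ≤ 1) ∧
    (∀ δ : Q.V → ℕ, IsAffine Q → IsMinImagRoot Q δ →
      extDim A B ≤ 2 ∧
      (extDim A B = 2 →
        (∀ v, Repn.dimv A v + Repn.dimv B v = δ v) ∧
        eulerZ Q (natc δ) (natc (Repn.dimv A)) = 1)) := by
  obtain ⟨⟨hAA, eAA⟩, ⟨hBB, eBB⟩, hAB, hBA, eBA⟩ := hpair
  have aa := homDim_sub_extDim A A hA hA
  have bb := homDim_sub_extDim B B hB hB
  have ab := homDim_sub_extDim A B hA hB
  have ba := homDim_sub_extDim B A hB hA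
  rw [hAA, eAA] at aa
  rw [hBB, eBB] at bb
  rw [hAB] at ab
  rw [hBA, eBA] at ba
  push_cast at aa bb ab ba
  have hq : titsZ Q (natc (A.dimv + B.dimv)) = 2 - extDim A B := by
    rw [natc_add]
    simp only [titsZ, eulerZ_add_left, eulerZ_add_right]
    linarith
  refine ⟨fun hD => ?_, fun δ haff hδ => ⟨?_, fun hd => ?_⟩⟩
  · have hne : natc (A.dimv + B.dimv) ≠ 0 := by
      intro h
      have hA0 : natc A.dimv = 0 := by
        funext v
        have := congrFun h v
        simp only [natc, Pi.add_apply, Pi.zero_apply] at this ⊢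
        omega
      rw [hA0] at aa
      simp [eulerZ] at aa
    have := hD.2 _ hne
    omega
  · have := haff.2.1 (natc (A.dimv + B.dimv))
    omega
  · rw [hd] at hq
    obtain ⟨m, hm⟩ := exists_mul_of_tits_zero Q δ haff.2.1 hδ _ (A.dimv + B.dimv) rfl
      (by simpa using hq)
    have hmZ : natc A.dimv + natc B.dimv = (m : ℤ) • natc δ := by
      rw [← natc_add, hm]; funext v; simp [natc]
    have h1 : (m : ℤ) * eulerZ Q (natc δ) (natc A.dimv) = 1 := by
      rw [← eulerZ_smul_left, ← hmZ, eulerZ_add_left]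
      linarith
    have hm1 : (m : ℤ) = 1 := by
      rcases Int.eq_one_or_neg_one_of_mul_eq_one h1 with h | h <;> omega
    have hm1' : m = 1 := by exact_mod_cast hm1
    refine ⟨fun v => ?_, ?_⟩
    · have := congrFun hm v
      simpa [hm1'] using this
    · rwa [hm1, one_mul] at h1
end
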